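/- Let v, u₁, u₂ be permutations of {1,…,n} with ℓ(u₁·v) = ℓ(u₁) + ℓ(v) and ℓ(v·u₂) = ℓ(v) + ℓ(u₂). Let w := v·u₂, and let (i_1,…,i_m) be a reduced word for w whose first ℓ(v) letters form a reduced word for v (i.e., v = s_{i_1}·s_{i_2}···s_{i_{ℓ(v)}}). In the Marsh–Rietsch setup over ℝ for this reduced word and this v, with all parameters t_r > 0: the matrix v̇⁻¹·g admits a UDL factorization, and there exists b ∈ B₋ such that every top-aligned flag minor of b·u̇₁·v̇·[v̇⁻¹g]_L^+ is nonnegative. -/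

import Mathlib

open Matrix Finset

namespace Paper

open scoped Classical

noncomputable section

variable {K : Type*} [Field K] {n m : ℕ}

/-- `N`: upper unitriangular matrices. -/
def IsN (g : Matrix (Fin n) (Fin n) K) : Prop :=
  (∀ i, g i i = 1) ∧ ∀ i j : Fin n, j < i → g i j = 0

/-- `N₋`: lower unitriangular matrices. -/
def IsNm (g : Matrix (Fin n) (Fin n) K) : Prop :=
  (∀ i, g i i = 1) ∧ ∀ i j : Fin n, i < j → g i j = 0

/-- `B`: upper triangular matrices of determinant 1. -/
def IsB (g : Matrix (Fin n) (Fin n) K) : Prop :=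
  g.det = 1 ∧ ∀ i j : Fin n, j < i → g i j = 0

/-- `B₋`: lower triangular matrices of determinant 1. -/
def IsBm (g : Matrix (Fin n) (Fin n) K) : Prop :=
  g.det = 1 ∧ ∀ i j : Fin n, i < j → g i j = 0

/-- `H`: diagonal matrices of determinant 1. -/
def IsH (g : Matrix (Fin n) (Fin n) K) : Prop :=
  g.det = 1 ∧ ∀ i j : Fin n, i ≠ j → g i j = 0

/-- UDL factorization: `g = yp * y0 * ym` with `yp ∈ N`, `y0 ∈ H`, `ym ∈ N₋`. -/
def UDL (g yp y0 ym : Matrix (Fin n) (Fin n) K) : Prop :=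
  IsN yp ∧ IsH y0 ∧ IsNm ym ∧ g = yp * y0 * ym

/-- LDU factorization: `g = zm * z0 * zp` with `zm ∈ N₋`, `z0 ∈ H`, `zp ∈ N`. -/
def LDU (g zm z0 zp : Matrix (Fin n) (Fin n) K) : Prop :=
  IsNm zm ∧ IsH z0 ∧ IsN zp ∧ g = zm * z0 * zp

/-- The signed permutation matrix `v̇`. -/
def pdot (v : Equiv.Perm (Fin n)) : Matrix (Fin n) (Fin n) K :=
  Matrix.of fun a b : Fin n =>
    if a = v b then
      (-1 : K) ^ (univ.filter fun k : Fin n => b < k ∧ v k < v b).card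
    else 0

/-- Membership in the double coset `B₋ w B₋`. -/
def InBmWBm (w : Equiv.Perm (Fin n)) (g : Matrix (Fin n) (Fin n) K) : Prop :=
  ∃ b₁ b₂ : Matrix (Fin n) (Fin n) K, IsBm b₁ ∧ IsBm b₂ ∧ g = b₁ * pdot w * b₂

/-- `Δ^I_J(g)`: the minor with row set `I` and column set `J` (junk value 0 if sizes differ). -/
def minor (g : Matrix (Fin n) (Fin n) K) (I J : Finset (Fin n)) : K :=
  if h : I.card = J.card then
    Matrix.det (Matrix.of fun a b : Fin I.card =>
      g (I.orderEmbOfFin rfl a) (J.orderEmbOfFin h.symm b))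
  else 0

/-- All right-aligned flag minors of `g` are nonnegative. -/
def RightFlagNonneg (g : Matrix (Fin n) (Fin n) ℝ) : Prop :=
  ∀ I : Finset (Fin n),
    0 ≤ minor g I (univ.filter fun j : Fin n => n - I.card ≤ (j : ℕ))

/-- All top-aligned flag minors of `g` are nonnegative. -/
def TopFlagNonneg (g : Matrix (Fin n) (Fin n) ℝ) : Prop :=
  ∀ J : Finset (Fin n),
    0 ≤ minor g (univ.filter fun i : Fin n => (i : ℕ) < J.card) J

/-- `x_i(t)` (with 1-based `i`): `Id + t·E_{i,i+1}`. -/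
def xmat (i : ℕ) (t : K) : Matrix (Fin n) (Fin n) K :=
  Matrix.of fun a b : Fin n =>
    if a = b then 1 else if (a : ℕ) + 1 = i ∧ (b : ℕ) = i then t else 0

/-- `y_i(t)` (with 1-based `i`): `Id + t·E_{i+1,i}`. -/
def ymat (i : ℕ) (t : K) : Matrix (Fin n) (Fin n) K :=
  Matrix.of fun a b : Fin n =>
    if a = b then 1 else if (a : ℕ) = i ∧ (b : ℕ) + 1 = i then t else 0

/-- `ṡ_i` (with 1-based `i`). -/
def sdot (i : ℕ) : Matrix (Fin n) (Fin n) K :=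
  Matrix.of fun a b : Fin n =>
    if (a : ℕ) + 1 = i ∧ (b : ℕ) = i then 1
    else if (a : ℕ) = i ∧ (b : ℕ) + 1 = i then -1
    else if a = b ∧ (a : ℕ) + 1 ≠ i ∧ (a : ℕ) ≠ i then 1
    else 0

/-- The adjacent transposition `s_i` (with 1-based `i`); identity if out of range. -/
def sperm (n : ℕ) (i : ℕ) : Equiv.Perm (Fin n) :=
  if h : i < n then
    Equiv.swap ⟨i - 1, Nat.lt_of_le_of_lt (Nat.sub_le i 1) h⟩ ⟨i, h⟩
  else 1

/-- `ℓ(w)`: the number of inversions of `w`. -/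
def len (w : Equiv.Perm (Fin n)) : ℕ :=
  (univ.filter fun p : Fin n × Fin n => p.1 < p.2 ∧ w p.2 < w p.1).card

/-- `vseq ii v k = v_{(m-k)}`: the rightmost (positive distinguished) subexpression recursion. -/
def vseq (ii : Fin m → ℕ) (v : Equiv.Perm (Fin n)) : ℕ → Equiv.Perm (Fin n)
  | 0 => v
  | k + 1 =>
    if h : m - k - 1 < m then
      if len (vseq ii v k * sperm n (ii ⟨m - k - 1, h⟩)) < len (vseq ii v k) then
        vseq ii v k * sperm n (ii ⟨m - k - 1, h⟩)
      else vseq ii v k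
    else vseq ii v k

/-- `r ∈ J°` (0-based `r`, corresponding to the 1-based index `r+1`). -/
def inJ (ii : Fin m → ℕ) (v : Equiv.Perm (Fin n)) (r : Fin m) : Prop :=
  vseq ii v (m - (r : ℕ)) = vseq ii v (m - (r : ℕ) - 1)

/-- The list `[s_{i_1}, …, s_{i_m}]` of adjacent transpositions. -/
def sPermList (n : ℕ) (ii : Fin m → ℕ) : List (Equiv.Perm (Fin n)) :=
  List.ofFn fun r => sperm n (ii r)

/-- The list `[s^v_{i_1}, …, s^v_{i_m}]`. -/
def svPermList (ii : Fin m → ℕ) (v : Equiv.Perm (Fin n)) : List (Equiv.Perm (Fin n)) :=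
  List.ofFn fun r => if inJ ii v r then 1 else sperm n (ii r)

/-- The factors `g_1, …, g_m` of the Marsh–Rietsch element. -/
def mrgList (ii : Fin m → ℕ) (v : Equiv.Perm (Fin n)) (t : Fin m → K) :
    List (Matrix (Fin n) (Fin n) K) :=
  List.ofFn fun r => if inJ ii v r then xmat (ii r) (t r) else sdot (ii r)

/-- The Marsh–Rietsch element `g = g_1 ⋯ g_m`. -/
def mrg (ii : Fin m → ℕ) (v : Equiv.Perm (Fin n)) (t : Fin m → K) :
    Matrix (Fin n) (Fin n) K :=
  (mrgList ii v t).prod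

/-- The list `[ṡ_{i_1}, …, ṡ_{i_m}]`. -/
def sdotList (n : ℕ) (ii : Fin m → ℕ) : List (Matrix (Fin n) (Fin n) K) :=
  List.ofFn fun r => sdot (ii r)

/-- `ẇ = ṡ_{i_1} ⋯ ṡ_{i_m}`. -/
def wMR (n : ℕ) (ii : Fin m → ℕ) : Matrix (Fin n) (Fin n) K :=
  (sdotList n ii).prod

set_option linter.all false
abbrev c0 (i : ℕ) (h : i + 1 < n) : Fin n := ⟨i, by omega⟩
abbrev c1 (i : ℕ) (h : i + 1 < n) : Fin n := ⟨i + 1, h⟩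
abbrev Sw (i : ℕ) (h : i + 1 < n) : Equiv.Perm (Fin n) := Equiv.swap (c0 i h) (c1 i h)
abbrev RM (n : ℕ) := Matrix (Fin n) (Fin n) ℝ
def Xm (i : ℕ) (t : ℝ) : RM n := xmat (i + 1) t
def Ym (i : ℕ) (t : ℝ) : RM n := ymat (i + 1) t
def Sm (i : ℕ) : RM n := sdot (i + 1)

def Lm (i : ℕ) (h : i + 1 < n) (α β γ : ℝ) : RM n :=
  Matrix.of fun a b : Fin n =>
    if b = c0 i h then (if a = c0 i h then α else if a = c1 i h then β else 0)
    else if b = c1 i h then (if a = c1 i h then γ else 0)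
    else if a = b then 1 else 0

def ep (v : Equiv.Perm (Fin n)) (b : Fin n) : ℝ :=
  (-1 : ℝ) ^ (univ.filter fun k : Fin n => b < k ∧ v k < v b).card

lemma ep_sq (v : Equiv.Perm (Fin n)) (b : Fin n) : ep v b * ep v b = 1 := by
  unfold ep; rw [← pow_add, ← two_mul, pow_mul]; norm_num

lemma mul_pdot (M : RM n) (v : Equiv.Perm (Fin n)) (a b : Fin n) :
    (M * (pdot v : RM n)) a b = M a (v b) * ep v b := by
  simp [Matrix.mul_apply, pdot, ep]

lemma pdotT_mul (M : RM n) (v : Equiv.Perm (Fin n)) (a b : Fin n) :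
    ((pdot v : RM n)ᵀ * M) a b = ep v a * M (v a) b := by
  simp [Matrix.mul_apply, pdot, ep]

lemma pdotT_pdot (v : Equiv.Perm (Fin n)) : (pdot v : RM n)ᵀ * pdot v = 1 := by
  ext a b
  rw [pdotT_mul]
  by_cases h : a = b
  · subst h; simp [pdot]; exact ep_sq v a
  · simp [pdot, h]

lemma pdot_pdotT (v : Equiv.Perm (Fin n)) : (pdot v : RM n) * (pdot v)ᵀ = 1 :=
  mul_eq_one_comm.mp (pdotT_pdot v)

lemma pdot_inv (v : Equiv.Perm (Fin n)) : (pdot v : RM n)⁻¹ = (pdot v)ᵀ :=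
  Matrix.inv_eq_left_inv (pdotT_pdot v)

lemma conj_pdot (M : RM n) (v : Equiv.Perm (Fin n)) (a b : Fin n) :
    ((pdot v : RM n)ᵀ * M * (pdot v : RM n) : RM n) a b = ep v a * ep v b * M (v a) (v b) := by
  rw [mul_pdot, pdotT_mul]; ring

lemma ep_Sw (i : ℕ) (h : i + 1 < n) (b : Fin n) :
    ep (Sw i h) b = if b = c0 i h then -1 else 1 := by
  unfold ep
  split_ifs with hb
  · subst hb
    have : (univ.filter fun k : Fin n => c0 i h < k ∧ Sw i h k < Sw i h (c0 i h)) = {c1 i h} := by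
      ext k
      simp only [mem_filter, mem_univ, true_and, mem_singleton, Equiv.swap_apply_def, Fin.lt_def, Fin.ext_iff]
      split_ifs <;> simp_all <;> omega
    rw [this]; simp
  · have : (univ.filter fun k : Fin n => b < k ∧ Sw i h k < Sw i h b) = ∅ := by
      ext k
      simp only [mem_filter, mem_univ, true_and, Equiv.swap_apply_def, Fin.lt_def, Fin.ext_iff, notMem_empty, iff_false] at hb ⊢
      split_ifs <;> simp_all <;> omega
    rw [this]; simp

lemma Sm_eq (i : ℕ) (h : i + 1 < n) : (Sm i : RM n) = pdot (Sw i h) := by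
  ext a b
  have e : (pdot (Sw i h) : RM n) a b = if a = Sw i h b then ep (Sw i h) b else 0 := rfl
  rw [e, ep_Sw]
  simp only [Sm, sdot, Matrix.of_apply, Equiv.swap_apply_def, Fin.ext_iff]
  split_ifs <;> simp_all <;> omega

lemma mul_Sm (i : ℕ) (h : i + 1 < n) (M : RM n) (a b : Fin n) :
    (M * Sm i : RM n) a b = if (b : ℕ) = i then - M a (c1 i h) else
      if (b : ℕ) = i + 1 then M a (c0 i h) else M a b := by
  rw [Sm_eq i h, mul_pdot, ep_Sw]
  simp only [Equiv.swap_apply_def, Fin.ext_iff]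
  split_ifs <;> simp_all

lemma Xm_eq (i : ℕ) (h : i + 1 < n) (t : ℝ) : (Xm i t : RM n) = transvection (c0 i h) (c1 i h) t := by
  ext a b
  simp only [Xm, xmat, transvection, Matrix.of_apply, Matrix.add_apply, Matrix.one_apply, Matrix.single_apply, Fin.ext_iff]
  split_ifs <;> simp_all <;> omega

lemma Ym_eq (i : ℕ) (h : i + 1 < n) (t : ℝ) : (Ym i t : RM n) = transvection (c1 i h) (c0 i h) t := by
  ext a b
  simp only [Ym, ymat, transvection, Matrix.of_apply, Matrix.add_apply, Matrix.one_apply, Matrix.single_apply, Fin.ext_iff]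
  split_ifs <;> simp_all <;> omega

lemma mul_Xm (i : ℕ) (h : i + 1 < n) (t : ℝ) (M : RM n) (a b : Fin n) :
    (M * Xm i t : RM n) a b = if (b : ℕ) = i + 1 then M a b + t * M a (c0 i h) else M a b := by
  rw [Xm_eq i h]
  split_ifs with hb
  · obtain rfl : b = c1 i h := Fin.ext hb
    rw [mul_transvection_apply_same]
  · rw [mul_transvection_apply_of_ne]; simpa [Fin.ext_iff] using hb

lemma Xm_mul (i : ℕ) (h : i + 1 < n) (t : ℝ) (M : RM n) (a b : Fin n) :
    (Xm i t * M : RM n) a b = if (a : ℕ) = i then M a b + t * M (c1 i h) b else M a b := by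
  rw [Xm_eq i h]
  split_ifs with hb
  · obtain rfl : a = c0 i h := Fin.ext hb
    rw [transvection_mul_apply_same]
  · rw [transvection_mul_apply_of_ne]; simpa [Fin.ext_iff] using hb

lemma mul_Ym (i : ℕ) (h : i + 1 < n) (t : ℝ) (M : RM n) (a b : Fin n) :
    (M * Ym i t : RM n) a b = if (b : ℕ) = i then M a b + t * M a (c1 i h) else M a b := by
  rw [Ym_eq i h]
  split_ifs with hb
  · obtain rfl : b = c0 i h := Fin.ext hb
    rw [mul_transvection_apply_same]
  · rw [mul_transvection_apply_of_ne]; simpa [Fin.ext_iff] using hb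

lemma mul_Lm (i : ℕ) (h : i + 1 < n) (α β γ : ℝ) (M : RM n) (a b : Fin n) :
    (M * Lm i h α β γ) a b = if (b : ℕ) = i then α * M a (c0 i h) + β * M a (c1 i h) else
      if (b : ℕ) = i + 1 then γ * M a (c1 i h) else M a b := by
  have e0 : (b : ℕ) = i ↔ b = c0 i h := by simp [Fin.ext_iff]
  have e1 : (b : ℕ) = i + 1 ↔ b = c1 i h := by simp [Fin.ext_iff]
  simp only [e0, e1, Matrix.mul_apply, Lm, Matrix.of_apply]
  split_ifs with h1 h2
  · have : ∀ c : Fin n, M a c * (if c = c0 i h then α else if c = c1 i h then β else 0)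
        = (if c = c0 i h then α * M a c else 0) + (if c = c1 i h then β * M a c else 0) := by
      intro c
      split_ifs with h3 h4
      · rw [h3] at h4; simp [Fin.ext_iff] at h4
      · ring
      · ring
      · ring
    simp_rw [this]
    rw [Finset.sum_add_distrib]; simp
  · simp [mul_comm]
  · simp

lemma ext3 (i : ℕ) (h : i + 1 + 1 < n) (A B : RM n)
    (e0 : ∀ p, A p ⟨i, by omega⟩ = B p ⟨i, by omega⟩)
    (e1 : ∀ p, A p ⟨i + 1, by omega⟩ = B p ⟨i + 1, by omega⟩)
    (e2 : ∀ p, A p ⟨i + 1 + 1, h⟩ = B p ⟨i + 1 + 1, h⟩)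
    (e3 : ∀ p (q : Fin n), (q : ℕ) ≠ i → (q : ℕ) ≠ i + 1 → (q : ℕ) ≠ i + 1 + 1 → A p q = B p q) :
    A = B := by
  ext p q
  by_cases h0 : (q : ℕ) = i
  · have hq : q = ⟨i, by omega⟩ := Fin.ext h0
    rw [hq]
    exact e0 p
  by_cases h1 : (q : ℕ) = i + 1
  · have hq : q = ⟨i + 1, by omega⟩ := Fin.ext h1
    rw [hq]
    exact e1 p
  by_cases h2 : (q : ℕ) = i + 1 + 1
  · have hq : q = ⟨i + 1 + 1, by omega⟩ := Fin.ext h2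
    rw [hq]
    exact e2 p
  exact e3 p q h0 h1 h2

lemma mul_ext (A B : RM n) (h : ∀ M : RM n, M * A = M * B) : A = B := by
  simpa using h 1

lemma na1 (i : ℕ) : ¬ (i = i + 1) := by omega
lemma na2 (i : ℕ) : ¬ (i = i + 1 + 1) := by omega
lemma na3 (i : ℕ) : ¬ (i + 1 = i) := by omega
lemma na4 (i : ℕ) : ¬ (i + 1 + 1 = i) := by omega

lemma br_xxx (i : ℕ) (h : i + 1 + 1 < n) (a b c : ℝ) (hac : a + c ≠ 0) :
    (Xm i a * Xm (i+1) b * Xm i c : RM n) = Xm (i+1) (b*c/(a+c)) * Xm i (a+c) * Xm (i+1) (a*b/(a+c)) := by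
  have h' : i + 1 < n := by omega
  refine mul_ext _ _ fun M => ?_
  simp only [← mul_assoc]
  apply ext3 i h
  all_goals intros; simp only [mul_Xm i h', mul_Xm (i+1) h, na1, na2, na3, na4, if_true, if_false, *]
  all_goals field_simp
  all_goals ring

lemma br_xxx' (i : ℕ) (h : i + 1 + 1 < n) (a b c : ℝ) (hac : a + c ≠ 0) :
    (Xm (i+1) a * Xm i b * Xm (i+1) c : RM n) = Xm i (b*c/(a+c)) * Xm (i+1) (a+c) * Xm i (a*b/(a+c)) := by
  have h' : i + 1 < n := by omega
  refine mul_ext _ _ fun M => ?_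
  simp only [← mul_assoc]
  apply ext3 i h
  all_goals intros; simp only [mul_Xm i h', mul_Xm (i+1) h, na1, na2, na3, na4, if_true, if_false, *]
  all_goals field_simp
  all_goals ring

lemma br_xxs (i : ℕ) (h : i + 1 + 1 < n) (a b : ℝ) :
    (Xm i a * Xm (i+1) b * Sm i : RM n) = Xm (i+1) b * Sm i * Xm (i+1) (a*b) * Ym i (-a) := by
  have h' : i + 1 < n := by omega
  refine mul_ext _ _ fun M => ?_
  simp only [← mul_assoc]
  apply ext3 i h
  all_goals intros; simp only [mul_Xm i h', mul_Xm (i+1) h, mul_Sm i h', mul_Ym i h', na1, na2, na3, na4, if_true, if_false, *]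
  all_goals ring

lemma br_xxs' (i : ℕ) (h : i + 1 + 1 < n) (a b : ℝ) :
    (Xm (i+1) a * Xm i b * Sm (i+1) : RM n) = Xm i b * Sm (i+1) * Xm i (a*b) * Ym (i+1) (-a) := by
  have h' : i + 1 < n := by omega
  refine mul_ext _ _ fun M => ?_
  simp only [← mul_assoc]
  apply ext3 i h
  all_goals intros; simp only [mul_Xm i h', mul_Xm (i+1) h, mul_Sm (i+1) h, mul_Ym (i+1) h, na1, na2, na3, na4, if_true, if_false, *]
  all_goals ring

lemma br_ssx (i : ℕ) (h : i + 1 + 1 < n) (a : ℝ) :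
    (Sm i * Sm (i+1) * Xm i a : RM n) = Xm (i+1) a * Sm i * Sm (i+1) := by
  have h' : i + 1 < n := by omega
  refine mul_ext _ _ fun M => ?_
  simp only [← mul_assoc]
  apply ext3 i h
  all_goals intros; simp only [mul_Xm i h', mul_Xm (i+1) h, mul_Sm i h', mul_Sm (i+1) h, na1, na2, na3, na4, if_true, if_false, *, neg_add, mul_neg]

lemma br_ssx' (i : ℕ) (h : i + 1 + 1 < n) (a : ℝ) :
    (Sm (i+1) * Sm i * Xm (i+1) a : RM n) = Xm i a * Sm (i+1) * Sm i := by
  have h' : i + 1 < n := by omega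
  refine mul_ext _ _ fun M => ?_
  simp only [← mul_assoc]
  apply ext3 i h
  all_goals intros; simp only [mul_Xm i h', mul_Xm (i+1) h, mul_Sm i h', mul_Sm (i+1) h, na1, na2, na3, na4, if_true, if_false, *, neg_add, mul_neg, neg_neg]

lemma br_sss (i : ℕ) (h : i + 1 + 1 < n) :
    (Sm i * Sm (i+1) * Sm i : RM n) = Sm (i+1) * Sm i * Sm (i+1) := by
  have h' : i + 1 < n := by omega
  refine mul_ext _ _ fun M => ?_
  simp only [← mul_assoc]
  apply ext3 i h
  all_goals intros; simp only [mul_Sm i h', mul_Sm (i+1) h, na1, na2, na3, na4, if_true, if_false, *]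

lemma ext4 (i j : ℕ) (h : i + 1 < n) (hj : j + 1 < n) (A B : RM n)
    (e0 : ∀ p, A p ⟨i, by omega⟩ = B p ⟨i, by omega⟩)
    (e1 : ∀ p, A p ⟨i + 1, by omega⟩ = B p ⟨i + 1, by omega⟩)
    (f0 : ∀ p, A p ⟨j, by omega⟩ = B p ⟨j, by omega⟩)
    (f1 : ∀ p, A p ⟨j + 1, by omega⟩ = B p ⟨j + 1, by omega⟩)
    (e3 : ∀ p (q : Fin n), (q : ℕ) ≠ i → (q : ℕ) ≠ i + 1 → (q : ℕ) ≠ j → (q : ℕ) ≠ j + 1 → A p q = B p q) :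
    A = B := by
  ext p q
  by_cases h0 : (q : ℕ) = i
  · have hq : q = ⟨i, by omega⟩ := Fin.ext h0
    rw [hq]
    exact e0 p
  by_cases h1 : (q : ℕ) = i + 1
  · have hq : q = ⟨i + 1, by omega⟩ := Fin.ext h1
    rw [hq]
    exact e1 p
  by_cases h2 : (q : ℕ) = j
  · have hq : q = ⟨j, by omega⟩ := Fin.ext h2
    rw [hq]
    exact f0 p
  by_cases h3 : (q : ℕ) = j + 1
  · have hq : q = ⟨j + 1, by omega⟩ := Fin.ext h3
    rw [hq]
    exact f1 p
  exact e3 p q h0 h1 h2 h3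

lemma cm_xx (i j : ℕ) (hi : i + 1 < n) (hj : j + 1 < n) (h1 : i + 1 < j ∨ j + 1 < i) (a b : ℝ) :
    (Xm i a * Xm j b : RM n) = Xm j b * Xm i a := by
  have k1 : ¬ (i = j) := by omega
  have k2 : ¬ (i = j + 1) := by omega
  have k3 : ¬ (j = i) := by omega
  have k4 : ¬ (j = i + 1) := by omega
  have k5 : ¬ (i + 1 = j + 1) := by omega
  have k6 : ¬ (j + 1 = i + 1) := by omega
  have k7 : ¬ (i + 1 = j) := by omega
  have k8 : ¬ (j + 1 = i) := by omega
  refine mul_ext _ _ fun M => ?_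
  simp only [← mul_assoc]
  apply ext4 i j hi hj
  all_goals intros; simp only [mul_Xm i hi, mul_Xm j hj, na1, na3, if_true, if_false, *]

lemma cm_xs (i j : ℕ) (hi : i + 1 < n) (hj : j + 1 < n) (h1 : i + 1 < j ∨ j + 1 < i) (a : ℝ) :
    (Xm i a * Sm j : RM n) = Sm j * Xm i a := by
  have k1 : ¬ (i = j) := by omega
  have k2 : ¬ (i = j + 1) := by omega
  have k3 : ¬ (j = i) := by omega
  have k4 : ¬ (j = i + 1) := by omega
  have k5 : ¬ (i + 1 = j + 1) := by omega
  have k6 : ¬ (j + 1 = i + 1) := by omega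
  have k7 : ¬ (i + 1 = j) := by omega
  have k8 : ¬ (j + 1 = i) := by omega
  refine mul_ext _ _ fun M => ?_
  simp only [← mul_assoc]
  apply ext4 i j hi hj
  all_goals intros; simp only [mul_Xm i hi, mul_Sm j hj, na1, na3, if_true, if_false, *]

lemma cm_ss (i j : ℕ) (hi : i + 1 < n) (hj : j + 1 < n) (h1 : i + 1 < j ∨ j + 1 < i) :
    (Sm i * Sm j : RM n) = Sm j * Sm i := by
  have k1 : ¬ (i = j) := by omega
  have k2 : ¬ (i = j + 1) := by omega
  have k3 : ¬ (j = i) := by omega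
  have k4 : ¬ (j = i + 1) := by omega
  have k5 : ¬ (i + 1 = j + 1) := by omega
  have k6 : ¬ (j + 1 = i + 1) := by omega
  have k7 : ¬ (i + 1 = j) := by omega
  have k8 : ¬ (j + 1 = i) := by omega
  refine mul_ext _ _ fun M => ?_
  simp only [← mul_assoc]
  apply ext4 i j hi hj
  all_goals intros; simp only [mul_Sm i hi, mul_Sm j hj, na1, na3, if_true, if_false, *]

lemma lx_far (i j : ℕ) (hi : i + 1 < n) (hj : j + 1 < n) (h1 : i + 1 < j ∨ j + 1 < i) (α β γ t : ℝ) :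
    (Lm i hi α β γ * Xm j t : RM n) = Xm j t * Lm i hi α β γ := by
  have k1 : ¬ (i = j) := by omega
  have k2 : ¬ (i = j + 1) := by omega
  have k3 : ¬ (j = i) := by omega
  have k4 : ¬ (j = i + 1) := by omega
  have k5 : ¬ (i + 1 = j + 1) := by omega
  have k6 : ¬ (j + 1 = i + 1) := by omega
  have k7 : ¬ (i + 1 = j) := by omega
  have k8 : ¬ (j + 1 = i) := by omega
  refine mul_ext _ _ fun M => ?_
  simp only [← mul_assoc]
  apply ext4 i j hi hj
  all_goals intros; simp only [mul_Lm i hi, mul_Xm j hj, na1, na3, if_true, if_false, *]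

lemma lx_up (i : ℕ) (h : i + 1 + 1 < n) (h' : i + 1 < n) (α β γ t : ℝ) :
    (Lm i h' α β γ * Xm (i+1) t : RM n) = Xm (i+1) (γ * t) * Lm i h' α β γ := by
  refine mul_ext _ _ fun M => ?_
  simp only [← mul_assoc]
  apply ext3 i h
  all_goals intros; simp only [mul_Lm i h', mul_Xm (i+1) h, na1, na2, na3, na4, if_true, if_false, *]
  all_goals ring

lemma lx_dn (i : ℕ) (h : i + 1 + 1 < n) (α β γ t : ℝ) (hα : α ≠ 0) :
    (Lm (i+1) h α β γ * Xm i t : RM n) = Xm i (t / α) * Lm (i+1) h α β γ := by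
  have h' : i + 1 < n := by omega
  refine mul_ext _ _ fun M => ?_
  simp only [← mul_assoc]
  apply ext3 i h
  all_goals intros; simp only [mul_Lm (i+1) h, mul_Xm i h', na1, na2, na3, na4, if_true, if_false, *]
  all_goals field_simp
  all_goals ring

lemma lx_same (i : ℕ) (h : i + 1 < n) (α β γ t : ℝ) (hγ : β * t + γ ≠ 0) :
    (Lm i h α β γ * Xm i t : RM n) =
      Xm i (α * t / (β * t + γ)) * Lm i h (α * γ / (β * t + γ)) β (β * t + γ) := by
  obtain ⟨δ, hδ⟩ : ∃ δ, δ = β * t + γ := ⟨_, rfl⟩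
  rw [← hδ] at hγ ⊢
  obtain rfl : γ = δ - β * t := by rw [hδ]; ring
  clear hδ
  refine mul_ext _ _ fun M => ?_
  simp only [← mul_assoc]
  apply ext4 i i h h
  all_goals intros; simp only [mul_Lm i h, mul_Xm i h, na1, na2, na3, na4, if_true, if_false, *]
  all_goals field_simp
  all_goals ring

def U (f : Fin n → ℤ) (m : RM n) : Prop := (∀ a, m a a = 1) ∧ ∀ a b, f b < f a → m a b = 0
def fi : Fin n → ℤ := fun a => ((a : ℕ) : ℤ)
def fng : Fin n → ℤ := fun a => -((a : ℕ) : ℤ)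
def fp (v : Equiv.Perm (Fin n)) : Fin n → ℤ := fun a => ((v a : ℕ) : ℤ)
def fnp (v : Equiv.Perm (Fin n)) : Fin n → ℤ := fun a => -((v a : ℕ) : ℤ)

lemma fi_inj : Function.Injective (fi : Fin n → ℤ) := fun a b h => by
  simp only [fi] at h; exact Fin.ext (by omega)
lemma fng_inj : Function.Injective (fng : Fin n → ℤ) := fun a b h => by
  simp only [fng] at h; exact Fin.ext (by omega)
lemma fp_inj (v : Equiv.Perm (Fin n)) : Function.Injective (fp v) := fun a b h => by
  simp only [fp] at h; exact v.injective (Fin.ext (by omega))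
lemma fnp_inj (v : Equiv.Perm (Fin n)) : Function.Injective (fnp v) := fun a b h => by
  simp only [fnp] at h; exact v.injective (Fin.ext (by omega))

lemma fi_lt {a b : Fin n} : fi a < fi b ↔ a < b := by
  unfold fi; rw [Fin.lt_def]; omega
lemma fng_lt {a b : Fin n} : fng a < fng b ↔ b < a := by
  unfold fng; rw [Fin.lt_def]; omega
lemma fp_lt {v : Equiv.Perm (Fin n)} {a b : Fin n} : fp v a < fp v b ↔ v a < v b := by
  unfold fp; rw [Fin.lt_def]; omega
lemma fnp_lt {v : Equiv.Perm (Fin n)} {a b : Fin n} : fnp v a < fnp v b ↔ v b < v a := by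
  unfold fnp; rw [Fin.lt_def]; omega

lemma U_one (f : Fin n → ℤ) : U f 1 := by
  refine ⟨fun a => by simp, fun a b h => ?_⟩
  rw [Matrix.one_apply_ne]; rintro rfl; exact lt_irrefl _ h

lemma U_mul {f : Fin n → ℤ} (hf : Function.Injective f) {A B : RM n} (hA : U f A) (hB : U f B) :
    U f (A * B) := by
  constructor
  · intro a
    rw [Matrix.mul_apply, Finset.sum_eq_single a]
    · rw [hA.1, hB.1, one_mul]
    · intro c _ hc
      rcases lt_trichotomy (f a) (f c) with h | h | h
      · rw [hB.2 c a h, mul_zero]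
      · exact absurd (hf h).symm hc
      · rw [hA.2 a c h, zero_mul]
    · simp
  · intro a b hab
    rw [Matrix.mul_apply]
    apply Finset.sum_eq_zero
    intro c _
    by_cases h : f c < f a
    · rw [hA.2 a c h, zero_mul]
    · rw [hB.2 c b (by omega), mul_zero]

lemma U_inv {f : Fin n → ℤ} (hf : Function.Injective f) {A : RM n} (hA : U f A)
    (hd : IsUnit A.det) : U f A⁻¹ := by
  letI : Invertible A := Matrix.invertibleOfIsUnitDet A hd
  have hb : BlockTriangular A f := fun a b h => hA.2 a b h
  have hbi : BlockTriangular A⁻¹ f := blockTriangular_inv_of_blockTriangular hb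
  refine ⟨fun a => ?_, fun a b h => hbi h⟩
  have h1 : (A⁻¹ * A) a a = 1 := by rw [Matrix.nonsing_inv_mul A hd]; simp
  rw [Matrix.mul_apply, Finset.sum_eq_single a] at h1
  · rwa [hA.1, mul_one] at h1
  · intro c _ hc
    rcases lt_trichotomy (f a) (f c) with h | h | h
    · rw [hA.2 c a h, mul_zero]
    · exact absurd (hf h).symm hc
    · rw [hbi h, zero_mul]
  · simp

lemma U_fi_det {A : RM n} (hA : U fi A) : A.det = 1 := by
  rw [Matrix.det_of_upperTriangular (fun a b h => hA.2 a b (fi_lt.2 h))]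
  simp [hA.1]

lemma U_fng_det {A : RM n} (hA : U fng A) : A.det = 1 := by
  rw [Matrix.det_of_lowerTriangular A (fun a b h => hA.2 a b (fng_lt.2 h))]
  simp [hA.1]

lemma Xm_apply (i : ℕ) (h : i + 1 < n) (t : ℝ) (a b : Fin n) :
    (Xm i t : RM n) a b = if a = b then 1 else if a = c0 i h ∧ b = c1 i h then t else 0 := by
  simp only [Xm, xmat, Matrix.of_apply, Fin.ext_iff]
  split_ifs <;> first | rfl | (exfalso; omega)

lemma Ym_apply (i : ℕ) (h : i + 1 < n) (t : ℝ) (a b : Fin n) :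
    (Ym i t : RM n) a b = if a = b then 1 else if a = c1 i h ∧ b = c0 i h then t else 0 := by
  simp only [Ym, ymat, Matrix.of_apply, Fin.ext_iff]
  split_ifs <;> first | rfl | (exfalso; omega)

lemma U_X {f : Fin n → ℤ} (i : ℕ) (h : i + 1 < n) (t : ℝ) (hf : f (c0 i h) < f (c1 i h)) :
    U f (Xm i t) := by
  refine ⟨fun a => by simp [Xm_apply i h], fun a b hab => ?_⟩
  rw [Xm_apply i h]
  split_ifs with h1 h2
  · subst h1; exact absurd hab (lt_irrefl _)
  · rw [h2.1, h2.2] at hab; omega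
  · rfl

lemma U_Y {f : Fin n → ℤ} (i : ℕ) (h : i + 1 < n) (t : ℝ) (hf : f (c1 i h) < f (c0 i h)) :
    U f (Ym i t) := by
  refine ⟨fun a => by simp [Ym_apply i h], fun a b hab => ?_⟩
  rw [Ym_apply i h]
  split_ifs with h1 h2
  · subst h1; exact absurd hab (lt_irrefl _)
  · rw [h2.1, h2.2] at hab; omega
  · rfl

lemma Xm_add (i : ℕ) (h : i + 1 < n) (s t : ℝ) : (Xm i s * Xm i t : RM n) = Xm i (s + t) := by
  rw [Xm_eq i h, Xm_eq i h, Xm_eq i h, transvection_mul_transvection_same]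
  simp [Fin.ext_iff]

lemma Xm_zero (i : ℕ) : (Xm i 0 : RM n) = 1 := by
  ext a b
  simp only [Xm, xmat, Matrix.of_apply, Matrix.one_apply]
  split_ifs <;> rfl

lemma Ym_add (i : ℕ) (h : i + 1 < n) (s t : ℝ) : (Ym i s * Ym i t : RM n) = Ym i (s + t) := by
  rw [Ym_eq i h, Ym_eq i h, Ym_eq i h, transvection_mul_transvection_same]
  simp [Fin.ext_iff]

lemma Ym_zero (i : ℕ) : (Ym i 0 : RM n) = 1 := by
  ext a b
  simp only [Ym, ymat, Matrix.of_apply, Matrix.one_apply]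
  split_ifs <;> rfl

lemma U_conj {f : Fin n → ℤ} (v : Equiv.Perm (Fin n)) {m : RM n} (hm : U f m) :
    U (f ∘ v) ((pdot v : RM n)ᵀ * m * (pdot v : RM n)) := by
  refine ⟨fun a => ?_, fun a b hab => ?_⟩
  · rw [conj_pdot, hm.1, ep_sq, one_mul]
  · rw [conj_pdot, hm.2 _ _ hab, mul_zero]

lemma U_conj' {f : Fin n → ℤ} (v : Equiv.Perm (Fin n)) {m : RM n} (hm : U (f ∘ v) m) :
    U f ((pdot v : RM n) * m * (pdot v : RM n)ᵀ) := by
  have key : ∀ a b, ((pdot v : RM n) * m * (pdot v : RM n)ᵀ) (v a) (v b) = ep v a * ep v b * m a b := by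
    intro a b
    have h := conj_pdot ((pdot v : RM n) * m * (pdot v : RM n)ᵀ) v a b
    have e : (pdot v : RM n)ᵀ * ((pdot v : RM n) * m * (pdot v : RM n)ᵀ) * pdot v = m := by
      have := pdotT_pdot v
      calc _ = ((pdot v : RM n)ᵀ * pdot v) * m * ((pdot v : RM n)ᵀ * pdot v) := by simp only [mul_assoc]
        _ = m := by rw [this]; simp
    rw [e] at h
    rw [h]
    have h1 := ep_sq v a
    have h2 := ep_sq v b
    linear_combination (-(((pdot v : RM n) * m * (pdot v : RM n)ᵀ) (v a) (v b))) * (h1 + h2 * (ep v a * ep v a))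
  refine ⟨fun a => ?_, fun a b hab => ?_⟩
  · obtain ⟨a, rfl⟩ := v.surjective a
    rw [key, hm.1, ep_sq, one_mul]
  · obtain ⟨a, rfl⟩ := v.surjective a
    obtain ⟨b, rfl⟩ := v.surjective b
    rw [key, hm.2 _ _ hab, mul_zero]

lemma Sw_lt (i : ℕ) (h : i + 1 < n) {a b : Fin n} (hab : a < b) :
    Sw i h a < Sw i h b ∨ (a = c0 i h ∧ b = c1 i h) := by
  simp only [Equiv.swap_apply_def, Fin.ext_iff, Fin.lt_def] at hab ⊢
  split_ifs <;> simp_all <;> omega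

lemma Sw0 (i : ℕ) (h : i + 1 < n) : Sw i h (c0 i h) = c1 i h := Equiv.swap_apply_left _ _
lemma Sw1 (i : ℕ) (h : i + 1 < n) : Sw i h (c1 i h) = c0 i h := Equiv.swap_apply_right _ _
lemma Sw_far (i : ℕ) (h : i + 1 < n) (a : Fin n) (h0 : (a : ℕ) ≠ i) (h1 : (a : ℕ) ≠ i + 1) :
    Sw i h a = a := Equiv.swap_apply_of_ne_of_ne (by simpa [Fin.ext_iff] using h0) (by simpa [Fin.ext_iff] using h1)
lemma Sw_sq (i : ℕ) (h : i + 1 < n) : Sw i h * Sw i h = 1 := Equiv.swap_mul_self _ _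

lemma conj_low (i : ℕ) (h : i + 1 < n) {m : RM n} (hm : U fng m) (h0 : m (c1 i h) (c0 i h) = 0) :
    U fng ((Sm i : RM n)ᵀ * m * Sm i) := by
  rw [Sm_eq i h]
  refine ⟨(U_conj _ hm).1, fun a b hab => ?_⟩
  rw [conj_pdot]
  rcases Sw_lt i h (fng_lt.1 hab) with h1 | ⟨rfl, rfl⟩
  · rw [hm.2 _ _ (fng_lt.2 h1), mul_zero]
  · rw [Sw0, Sw1, h0, mul_zero]

lemma conj_up (i : ℕ) (h : i + 1 < n) {m : RM n} (hm : U fi m) (h0 : m (c0 i h) (c1 i h) = 0) :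
    U fi ((Sm i : RM n)ᵀ * m * Sm i) := by
  rw [Sm_eq i h]
  refine ⟨(U_conj _ hm).1, fun a b hab => ?_⟩
  rw [conj_pdot]
  rcases Sw_lt i h (fi_lt.1 hab) with h1 | ⟨rfl, rfl⟩
  · rw [hm.2 _ _ (fi_lt.2 h1), mul_zero]
  · rw [Sw0, Sw1, h0, mul_zero]

lemma SmT (i : ℕ) (h : i + 1 < n) : (Sm i : RM n) * (Sm i)ᵀ = 1 := by rw [Sm_eq i h, pdot_pdotT]
lemma SmT' (i : ℕ) (h : i + 1 < n) : (Sm i : RM n)ᵀ * Sm i = 1 := by rw [Sm_eq i h, pdotT_pdot]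

def D (v : Equiv.Perm (Fin n)) (m : RM n) : Prop := U (fp v) m ∧ U fng m

lemma D_one (v : Equiv.Perm (Fin n)) : D v 1 := ⟨U_one _, U_one _⟩
lemma D_mul {v : Equiv.Perm (Fin n)} {A B : RM n} (hA : D v A) (hB : D v B) : D v (A * B) :=
  ⟨U_mul (fp_inj v) hA.1 hB.1, U_mul fng_inj hA.2 hB.2⟩

lemma c01 (i : ℕ) (h : i + 1 < n) : c0 i h < c1 i h := by simp [Fin.lt_def]

lemma D_Y {v : Equiv.Perm (Fin n)} (i : ℕ) (h : i + 1 < n) (hv : v (c1 i h) < v (c0 i h)) (t : ℝ) :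
    D v (Ym i t) := ⟨U_Y i h t (fp_lt.2 hv), U_Y i h t (fng_lt.2 (c01 i h))⟩

lemma push_x {v : Equiv.Perm (Fin n)} (i : ℕ) (h : i + 1 < n) (hv : v (c0 i h) < v (c1 i h))
    (t : ℝ) {m : RM n} (hm : D v m) : ∃ m', D v m' ∧ m * Xm i t = Xm i t * m' := by
  refine ⟨Xm i (-t) * m * Xm i t, ⟨?_, ?_⟩, ?_⟩
  · exact U_mul (fp_inj v) (U_mul (fp_inj v) (U_X i h _ (fp_lt.2 hv)) hm.1) (U_X i h _ (fp_lt.2 hv))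
  · have h0 : m (c1 i h) (c0 i h) = 0 := hm.1.2 _ _ (fp_lt.2 hv)
    have hd := hm.2.1
    have hl : ∀ a b : Fin n, a < b → m a b = 0 := fun a b hab => hm.2.2 a b (fng_lt.2 hab)
    constructor
    · intro a
      rw [mul_Xm i h, Xm_mul i h, Xm_mul i h]
      by_cases ha : (a : ℕ) = i
      · have : a = c0 i h := Fin.ext ha
        subst this
        simp [hd, h0]
      · by_cases ha1 : (a : ℕ) = i + 1
        · have : a = c1 i h := Fin.ext ha1
          subst this
          simp [hd, h0]
        · simp [ha, ha1, hd]
    · intro a b hab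
      rw [fng_lt] at hab
      rw [mul_Xm i h, Xm_mul i h, Xm_mul i h]
      by_cases ha : (a : ℕ) = i
      · have : a = c0 i h := Fin.ext ha
        subst this
        by_cases hb : b = c1 i h
        · subst hb; simp [hd, h0, hl _ _ hab]
        · have hb' : ¬ (b : ℕ) = i + 1 := fun hh => hb (Fin.ext hh)
          have : c1 i h < b := by
            simp only [Fin.lt_def] at hab ⊢; omega
          simp [hb', hl _ _ hab, hl _ _ this]
      · by_cases hb : b = c1 i h
        · subst hb
          have : a < c0 i h := by simp only [Fin.lt_def] at hab ⊢; omega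
          simp [ha, hl _ _ hab, hl _ _ this]
        · have hb' : ¬ (b : ℕ) = i + 1 := fun hh => hb (Fin.ext hh)
          simp [ha, hb', hl _ _ hab]
  · rw [← mul_assoc, ← mul_assoc, Xm_add i h]
    simp [Xm_zero]

lemma fp_mul (v s : Equiv.Perm (Fin n)) : fp (v * s) = fp v ∘ s := rfl
lemma fnp_mul (v s : Equiv.Perm (Fin n)) : fnp (v * s) = fnp v ∘ s := rfl

lemma push_s {v : Equiv.Perm (Fin n)} (i : ℕ) (h : i + 1 < n) (hv : v (c0 i h) < v (c1 i h))
    {m : RM n} (hm : D v m) : D (v * Sw i h) ((Sm i : RM n)ᵀ * m * Sm i) ∧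
      m * Sm i = Sm i * ((Sm i : RM n)ᵀ * m * Sm i) := by
  have h0 : m (c1 i h) (c0 i h) = 0 := hm.1.2 _ _ (fp_lt.2 hv)
  refine ⟨⟨?_, conj_low i h hm.2 h0⟩, ?_⟩
  · rw [fp_mul, Sm_eq i h]; exact U_conj _ hm.1
  · rw [← mul_assoc, ← mul_assoc, SmT i h, one_mul]

/-- one Marsh–Rietsch step -/
def Step (i : ℕ) (h : i + 1 < n) (v' v : Equiv.Perm (Fin n)) (G : RM n) : Prop :=
  v' (c0 i h) < v' (c1 i h) ∧
  ((v = v' ∧ ∃ t, 0 < t ∧ G = Xm i t) ∨ (v = v' * Sw i h ∧ G = Sm i))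

lemma push {i : ℕ} {h : i + 1 < n} {v' v : Equiv.Perm (Fin n)} {G m : RM n}
    (hs : Step i h v' v G) (hm : D v' m) : ∃ m', D v m' ∧ m * G = G * m' := by
  obtain ⟨ha, ⟨rfl, t, ht, rfl⟩ | ⟨rfl, rfl⟩⟩ := hs
  · exact push_x i h ha t hm
  · exact ⟨_, push_s i h ha hm⟩

inductive MR : ℕ → Equiv.Perm (Fin n) → Equiv.Perm (Fin n) → RM n → Prop
  | one : MR 0 1 1 1
  | step (k i : ℕ) (h : i + 1 < n) (v' v w : Equiv.Perm (Fin n)) (g G m : RM n) :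
      MR k v' w g → Step i h v' v G → w (c0 i h) < w (c1 i h) → D v m →
      MR (k + 1) v (w * Sw i h) (g * G * m)

inductive TP : ℕ → Equiv.Perm (Fin n) → RM n → Prop
  | one : TP 0 1 1
  | step (k j : ℕ) (h : j + 1 < n) (y : Equiv.Perm (Fin n)) (z : RM n) (a : ℝ) :
      TP k y z → y (c0 j h) < y (c1 j h) → 0 < a → TP (k + 1) (y * Sw j h) (Xm j a * z)

abbrev Adj (i j : ℕ) : Prop := j = i + 1 ∨ i = j + 1

lemma bxxx (i j : ℕ) (hi : i + 1 < n) (hj : j + 1 < n) (ha : Adj i j) (a b c : ℝ) (hac : a + c ≠ 0) :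
    (Xm i a * Xm j b * Xm i c : RM n) = Xm j (b*c/(a+c)) * Xm i (a+c) * Xm j (a*b/(a+c)) := by
  rcases ha with rfl | rfl
  · exact br_xxx i hj a b c hac
  · exact br_xxx' j hi a b c hac

lemma bxxs (i j : ℕ) (hi : i + 1 < n) (hj : j + 1 < n) (ha : Adj i j) (a b : ℝ) :
    (Xm i a * Xm j b * Sm i : RM n) = Xm j b * Sm i * Xm j (a*b) * Ym i (-a) := by
  rcases ha with rfl | rfl
  · exact br_xxs i hj a b
  · exact br_xxs' j hi a b

lemma bssx (i j : ℕ) (hi : i + 1 < n) (hj : j + 1 < n) (ha : Adj i j) (a : ℝ) :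
    (Sm i * Sm j * Xm i a : RM n) = Xm j a * Sm i * Sm j := by
  rcases ha with rfl | rfl
  · exact br_ssx i hj a
  · exact br_ssx' j hi a

lemma bsss (i j : ℕ) (hi : i + 1 < n) (hj : j + 1 < n) (ha : Adj i j) :
    (Sm i * Sm j * Sm i : RM n) = Sm j * Sm i * Sm j := by
  rcases ha with rfl | rfl
  · exact br_sss i hj
  · exact (br_sss j hi).symm

lemma Sw_val (i : ℕ) (h : i + 1 < n) (x : Fin n) :
    ((Sw i h x : Fin n) : ℕ) = if (x : ℕ) = i then i + 1 else if (x : ℕ) = i + 1 then i else x := by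
  simp only [Equiv.swap_apply_def, Fin.ext_iff]
  split_ifs <;> rfl

lemma Sw_br0 (i : ℕ) (hi : i + 1 < n) (hj : i + 1 + 1 < n) :
    Sw i hi * Sw (i+1) hj * Sw i hi = Sw (i+1) hj * Sw i hi * Sw (i+1) hj := by
  ext x
  simp only [Equiv.Perm.mul_apply, Sw_val]
  split_ifs <;> omega

lemma Sw_br (i j : ℕ) (hi : i + 1 < n) (hj : j + 1 < n) (ha : Adj i j) :
    Sw i hi * Sw j hj * Sw i hi = Sw j hj * Sw i hi * Sw j hj := by
  rcases ha with rfl | rfl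
  · exact Sw_br0 i hi hj
  · exact (Sw_br0 j hj hi).symm

abbrev Far (i j : ℕ) : Prop := i + 1 < j ∨ j + 1 < i

lemma Sw_cm (i j : ℕ) (hi : i + 1 < n) (hj : j + 1 < n) (h : Far i j) :
    Sw i hi * Sw j hj = Sw j hj * Sw i hi := by
  ext x
  simp only [Equiv.Perm.mul_apply, Sw_val]
  split_ifs <;> omega

lemma far0 (i j : ℕ) (hi : i + 1 < n) (hj : j + 1 < n) (h : Far i j) :
    Sw j hj (c0 i hi) = c0 i hi := Sw_far j hj _ (by simp; omega) (by simp; omega)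
lemma far1 (i j : ℕ) (hi : i + 1 < n) (hj : j + 1 < n) (h : Far i j) :
    Sw j hj (c1 i hi) = c1 i hi := Sw_far j hj _ (by simp; omega) (by simp; omega)

lemma adj0 (i j : ℕ) (hi : i + 1 < n) (hj : j + 1 < n) (ha : Adj i j) :
    Sw i hi (Sw j hj (c0 i hi)) = c0 j hj ∧ Sw i hi (Sw j hj (c1 i hi)) = c1 j hj := by
  rcases ha with rfl | rfl <;>
  constructor <;> ext <;> simp only [Sw_val] <;>
  split_ifs <;> omega

lemma adj1 (i j : ℕ) (hi : i + 1 < n) (hj : j + 1 < n) (ha : Adj i j) :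
    Sw j hj (c0 i hi) = Sw i hi (c0 j hj) ∧ Sw j hj (c1 i hi) = Sw i hi (c1 j hj) := by
  rcases ha with rfl | rfl <;>
  constructor <;> ext <;> simp only [Sw_val] <;>
  split_ifs <;> omega

def As (y : Equiv.Perm (Fin n)) (i : ℕ) (h : i + 1 < n) : Prop := y (c0 i h) < y (c1 i h)
def Ds (y : Equiv.Perm (Fin n)) (i : ℕ) (h : i + 1 < n) : Prop := y (c1 i h) < y (c0 i h)

lemma nAs {y : Equiv.Perm (Fin n)} {i : ℕ} {h : i + 1 < n} : ¬ As y i h ↔ Ds y i h := by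
  unfold As Ds
  have : y (c0 i h) ≠ y (c1 i h) := fun e => (c01 i h).ne (y.injective e)
  constructor
  · intro hh; exact lt_of_le_of_ne (not_lt.1 hh) this.symm
  · intro hh; exact not_lt.2 hh.le

lemma As_same {y : Equiv.Perm (Fin n)} {i : ℕ} {h : i + 1 < n} : As (y * Sw i h) i h ↔ Ds y i h := by
  unfold As Ds; simp only [Equiv.Perm.mul_apply, Sw0, Sw1]
lemma Ds_same {y : Equiv.Perm (Fin n)} {i : ℕ} {h : i + 1 < n} : Ds (y * Sw i h) i h ↔ As y i h := by
  unfold As Ds; simp only [Equiv.Perm.mul_apply, Sw0, Sw1]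

lemma As_far {y : Equiv.Perm (Fin n)} {i j : ℕ} {h : i + 1 < n} {hj : j + 1 < n} (hf : Far i j) :
    As (y * Sw j hj) i h ↔ As y i h := by
  unfold As; rw [Equiv.Perm.mul_apply, Equiv.Perm.mul_apply, far0 i j h hj hf, far1 i j h hj hf]
lemma Ds_far {y : Equiv.Perm (Fin n)} {i j : ℕ} {h : i + 1 < n} {hj : j + 1 < n} (hf : Far i j) :
    Ds (y * Sw j hj) i h ↔ Ds y i h := by
  rw [← nAs, ← nAs, As_far hf]

lemma As_ij {y : Equiv.Perm (Fin n)} {i j : ℕ} {hi : i + 1 < n} {hj : j + 1 < n} (ha : Adj i j) :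
    As (y * Sw i hi * Sw j hj) i hi ↔ As y j hj := by
  unfold As; simp only [Equiv.Perm.mul_apply]
  rw [(adj0 i j hi hj ha).1, (adj0 i j hi hj ha).2]

lemma As_sw {y : Equiv.Perm (Fin n)} {i j : ℕ} {hi : i + 1 < n} {hj : j + 1 < n} (ha : Adj i j) :
    As (y * Sw j hj) i hi ↔ As (y * Sw i hi) j hj := by
  unfold As; simp only [Equiv.Perm.mul_apply]
  rw [(adj1 i j hi hj ha).1, (adj1 i j hi hj ha).2]

lemma As_both {y : Equiv.Perm (Fin n)} {i j : ℕ} {hi : i + 1 < n} {hj : j + 1 < n} (ha : Adj i j)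
    (h1 : As y i hi) (h2 : As y j hj) : As (y * Sw j hj) i hi := by
  unfold As at *
  rcases ha with rfl | rfl
  · have e1 : Sw (i+1) hj (c0 i hi) = c0 i hi := Sw_far _ _ _ (by simp) (by simp; omega)
    have e2 : Sw (i+1) hj (c1 i hi) = c1 (i+1) hj := Sw0 _ _
    rw [Equiv.Perm.mul_apply, Equiv.Perm.mul_apply, e1, e2]; exact h1.trans h2
  · have e1 : Sw j hj (c1 (j+1) hi) = c1 (j+1) hi := Sw_far _ _ _ (by simp; omega) (by simp)
    have e2 : Sw j hj (c0 (j+1) hi) = c0 j hj := Sw1 _ _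
    rw [Equiv.Perm.mul_apply, Equiv.Perm.mul_apply, e1, e2]; exact h2.trans h1

lemma tri (i j : ℕ) : i = j ∨ Far i j ∨ Adj i j := by unfold Far Adj; omega

/-- the rank two facts used in both exchange lemmas -/
lemma rk2 {y : Equiv.Perm (Fin n)} {i j : ℕ} {hi : i + 1 < n} {hj : j + 1 < n} (ha : Adj i j)
    (h1 : As y j hj) (h2 : Ds (y * Sw j hj) i hi) :
    Ds y i hi ∧ Ds (y * Sw i hi) j hj ∧ As (y * Sw i hi * Sw j hj) i hi ∧
      As (y * Sw i hi * Sw j hj * Sw i hi) j hj := by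
  have a1 : Ds y i hi := by
    rw [← nAs] at h2 ⊢; exact fun h => h2 (As_both ha h h1)
  refine ⟨a1, ?_, (As_ij ha).2 h1, ?_⟩
  · rw [← nAs] at h2 ⊢; rwa [← As_sw ha]
  · rw [As_ij ha.symm]; exact As_same.2 a1

lemma wbr (w : Equiv.Perm (Fin n)) (i j : ℕ) (hi : i + 1 < n) (hj : j + 1 < n) (ha : Adj i j) :
    w * Sw i hi * Sw j hj * Sw i hi * Sw j hj = w * Sw j hj * Sw i hi := by
  have h := Sw_br i j hi hj ha
  calc _ = w * (Sw i hi * Sw j hj * Sw i hi) * Sw j hj := by simp only [mul_assoc]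
    _ = w * Sw j hj * Sw i hi * (Sw j hj * Sw j hj) := by rw [h]; simp only [mul_assoc]
    _ = _ := by rw [Sw_sq, mul_one]

lemma mSS (w : Equiv.Perm (Fin n)) (i : ℕ) (hi : i + 1 < n) : w * Sw i hi * Sw i hi = w := by
  rw [mul_assoc, Sw_sq, mul_one]

lemma Ds_one {i : ℕ} {hi : i + 1 < n} (h : Ds (1 : Equiv.Perm (Fin n)) i hi) : False :=
  absurd h (not_lt.2 (c01 i hi).le)

lemma TP_U {k : ℕ} {y : Equiv.Perm (Fin n)} {z : RM n} (h : TP k y z) : U fi z := by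
  induction h with
  | one => exact U_one _
  | step k j h y z a _ _ _ ih => exact U_mul fi_inj (U_X j h a (fi_lt.2 (c01 j h))) ih

lemma TP_ex (k : ℕ) : ∀ (y : Equiv.Perm (Fin n)) (z : RM n), TP k y z →
    ∀ (i : ℕ) (hi : i + 1 < n), Ds y i hi →
    ∃ k' a z', k = k' + 1 ∧ 0 < a ∧ TP k' (y * Sw i hi) z' ∧ z = Xm i a * z' := by
  induction k using Nat.strong_induction_on with
  | _ k IH =>
  intro y z hT i hi hd
  cases hT with
  | one => exact (Ds_one hd).elim
  | step k0 j hj y0 z0 a hT0 has ha =>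
    have has' : As y0 j hj := has
    rcases tri i j with rfl | hf | hadj
    · exact ⟨k0, a, z0, rfl, ha, by rw [mSS]; exact hT0, rfl⟩
    · obtain ⟨k1, b, z1, rfl, hb, hT1, rfl⟩ := IH k0 (by omega) _ _ hT0 i hi ((Ds_far hf).1 hd)
      refine ⟨k1 + 1, b, Xm j a * z1, rfl, hb, ?_, ?_⟩
      · rw [mul_assoc, ← Sw_cm i j hi hj hf, ← mul_assoc]
        exact TP.step _ _ _ _ _ _ hT1 ((As_far hf.symm).2 has') ha
      · rw [← mul_assoc, ← mul_assoc, cm_xx i j hi hj hf]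
    · obtain ⟨d1, d2, a1, a2⟩ := rk2 hadj has' hd
      obtain ⟨k1, b, z1, rfl, hb, hT1, rfl⟩ := IH k0 (by omega) _ _ hT0 i hi d1
      obtain ⟨k2, c, z2, rfl, hc, hT2, rfl⟩ := IH k1 (by omega) _ _ hT1 j hj d2
      have hT3 := TP.step _ i hi _ _ (a*b/(a+c)) hT2 a1 (by positivity)
      have hT4 := TP.step _ j hj _ _ (a+c) hT3 a2 (by positivity)
      refine ⟨_, b*c/(a+c), (Xm j (a + c) * (Xm i (a * b / (a + c)) * z2)), rfl, by positivity, ?_, ?_⟩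
      · rw [← wbr y0 i j hi hj hadj]; exact hT4
      · have := bxxx j i hj hi hadj.symm a b c (by positivity)
        simp only [← mul_assoc]
        rw [this]

lemma TP_app {k : ℕ} {y : Equiv.Perm (Fin n)} {z : RM n} (h : TP k y z) :
    ∀ (i : ℕ) (hi : i + 1 < n) (t : ℝ), 0 < t → As y⁻¹ i hi →
    TP (k + 1) (Sw i hi * y) (z * Xm i t) := by
  induction h with
  | one =>
    intro i hi t ht _
    have := TP.step 0 i hi 1 1 t TP.one (c01 i hi) ht
    simpa using this
  | step k j hj y0 z0 a hT has ha ih =>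
    intro i hi t ht hA
    have hA' : Sw j hj (y0⁻¹ (c0 i hi)) < Sw j hj (y0⁻¹ (c1 i hi)) := by
      have := hA; unfold As at this
      simpa [_root_.mul_inv_rev] using this
    have h1 : As y0⁻¹ i hi := by
      rcases Sw_lt j hj hA' with h | ⟨h, h'⟩
      · unfold As; simpa using h
      · exfalso
        have e1 : y0⁻¹ (c0 i hi) = c1 j hj := by
          rw [← Sw0 j hj] ; rw [← h]; simp
        have e2 : y0⁻¹ (c1 i hi) = c0 j hj := by
          rw [← Sw1 j hj] ; rw [← h']; simp
        rw [Equiv.Perm.inv_eq_iff_eq] at e1 e2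
        rw [← e1, ← e2] at has
        exact absurd has (not_lt.2 (c01 i hi).le)
    have h2 := ih i hi t ht h1
    rw [mul_assoc, ← mul_assoc (Sw i hi)]
    refine TP.step _ _ _ _ _ _ h2 ?_ ha
    rw [Equiv.Perm.mul_apply, Equiv.Perm.mul_apply]
    rcases Sw_lt i hi has with h | ⟨h, h'⟩
    · exact h
    · exfalso
      have e1 : y0⁻¹ (c0 i hi) = c0 j hj := by rw [← h]; simp
      have e2 : y0⁻¹ (c1 i hi) = c1 j hj := by rw [← h']; simp
      rw [e1, e2, Sw0, Sw1] at hA'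
      exact absurd hA' (not_lt.2 (c01 j hj).le)

lemma TP_L (i : ℕ) (hi : i + 1 < n) {k : ℕ} {y : Equiv.Perm (Fin n)} {z : RM n} (h : TP k y z) :
    ∀ α β γ : ℝ, 0 < α → 0 < β → 0 < γ → ∃ z' α' β' γ', 0 < α' ∧ 0 < β' ∧ 0 < γ' ∧
      TP k y z' ∧ Lm i hi α β γ * z = z' * Lm i hi α' β' γ' := by
  induction h with
  | one => intro α β γ h1 h2 h3; exact ⟨1, α, β, γ, h1, h2, h3, TP.one, by simp⟩
  | step k j hj y0 z0 a hT has ha ih =>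
    intro α β γ h1 h2 h3
    have key : ∃ a' α₁ β₁ γ₁, 0 < a' ∧ 0 < α₁ ∧ 0 < β₁ ∧ 0 < γ₁ ∧
        (Lm i hi α β γ * Xm j a : RM n) = Xm j a' * Lm i hi α₁ β₁ γ₁ := by
      rcases tri i j with rfl | hf | rfl | rfl
      · exact ⟨_, _, _, _, by positivity, by positivity, by positivity, by positivity,
          lx_same i hi α β γ a (by positivity)⟩
      · exact ⟨_, _, _, _, ha, h1, h2, h3, lx_far i j hi hj hf α β γ a⟩
      · exact ⟨_, _, _, _, by positivity, h1, h2, h3, lx_up i hj hi α β γ a⟩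
      · exact ⟨_, _, _, _, by positivity, h1, h2, h3, lx_dn j hi α β γ a h1.ne'⟩
    obtain ⟨a', α₁, β₁, γ₁, ha', h1', h2', h3', e⟩ := key
    obtain ⟨z', α', β', γ', g1, g2, g3, hz, e'⟩ := ih α₁ β₁ γ₁ h1' h2' h3'
    refine ⟨Xm j a' * z', α', β', γ', g1, g2, g3, TP.step _ _ _ _ _ _ hz has ha', ?_⟩
    rw [← mul_assoc, e, mul_assoc, e', mul_assoc]

lemma step_far {i j : ℕ} {hi : i + 1 < n} {hj : j + 1 < n} (hf : Far i j)
    {v1 v0 v : Equiv.Perm (Fin n)} {G1 G : RM n} (s1 : Step i hi v1 v0 G1) (s2 : Step j hj v0 v G) :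
    ∃ v0', Step j hj v1 v0' G ∧ Step i hi v0' v G1 ∧ G1 * G = G * G1 := by
  obtain ⟨a1, ⟨rfl, t, ht, rfl⟩ | ⟨rfl, rfl⟩⟩ := s1 <;>
  obtain ⟨a2, ⟨rfl, t', ht', rfl⟩ | ⟨rfl, rfl⟩⟩ := s2
  · exact ⟨_, ⟨a2, Or.inl ⟨rfl, t', ht', rfl⟩⟩, ⟨a1, Or.inl ⟨rfl, t, ht, rfl⟩⟩, cm_xx i j hi hj hf _ _⟩
  · exact ⟨_, ⟨a2, Or.inr ⟨rfl, rfl⟩⟩, ⟨(As_far hf).2 a1, Or.inl ⟨rfl, t, ht, rfl⟩⟩, cm_xs i j hi hj hf _⟩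
  · exact ⟨_, ⟨(As_far hf.symm).1 a2, Or.inl ⟨rfl, t', ht', rfl⟩⟩, ⟨a1, Or.inr ⟨rfl, rfl⟩⟩,
      (cm_xs j i hj hi hf.symm _).symm⟩
  · exact ⟨_, ⟨(As_far hf.symm).1 a2, Or.inr ⟨rfl, rfl⟩⟩, ⟨(As_far hf).2 a1, Or.inr ⟨by
      rw [mul_assoc, Sw_cm i j hi hj hf, mul_assoc], rfl⟩⟩, cm_ss i j hi hj hf⟩

lemma step_adj {i j : ℕ} {hi : i + 1 < n} {hj : j + 1 < n} (hadj : Adj i j)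
    {y v1 v0 v : Equiv.Perm (Fin n)} {G2 G1 G : RM n} (s2 : Step j hj y v1 G2)
    (s1 : Step i hi v1 v0 G1) (s0 : Step j hj v0 v G) :
    ∃ a b H1 H2 H3 q, Step i hi y a H1 ∧ Step j hj a b H2 ∧ Step i hi b v H3 ∧ D v q ∧
      G2 * G1 * G = H1 * H2 * H3 * q := by
  have hs := hadj.symm
  obtain ⟨a2, ⟨rfl, p, hp, rfl⟩ | ⟨rfl, rfl⟩⟩ := s2 <;>
  obtain ⟨a1, ⟨rfl, r, hr, rfl⟩ | ⟨rfl, rfl⟩⟩ := s1 <;>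
  obtain ⟨a0, ⟨rfl, q, hq, rfl⟩ | ⟨rfl, rfl⟩⟩ := s0
  · -- xxx
    exact ⟨_, _, _, _, _, 1, ⟨a1, Or.inl ⟨rfl, r*q/(p+q), by positivity, rfl⟩⟩,
      ⟨a2, Or.inl ⟨rfl, p+q, by positivity, rfl⟩⟩, ⟨a1, Or.inl ⟨rfl, p*r/(p+q), by positivity, rfl⟩⟩,
      D_one _, by rw [bxxx j i hj hi hs p r q (by positivity), mul_one]⟩
  · -- xxs
    exact ⟨_, _, _, _, _, _, ⟨a1, Or.inl ⟨rfl, r, hr, rfl⟩⟩, ⟨a2, Or.inr ⟨rfl, rfl⟩⟩,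
      ⟨As_both hadj a1 a2, Or.inl ⟨rfl, p*r, by positivity, rfl⟩⟩, D_Y j hj (Ds_same.2 a2) (-p),
      bxxs j i hj hi hs p r⟩
  · -- xsx
    refine ⟨_, _, _, _, _, _, ⟨a1, Or.inl ⟨rfl, q/p, by positivity, rfl⟩⟩,
      ⟨a2, Or.inl ⟨rfl, p, by positivity, rfl⟩⟩, ⟨a1, Or.inr ⟨rfl, rfl⟩⟩,
      D_Y i hi (Ds_same.2 a1) (q/p), ?_⟩
    rw [bxxs i j hi hj hadj, mul_assoc _ (Ym i _) (Ym i _), Ym_add i hi, neg_add_cancel, Ym_zero,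
      mul_one, div_mul_cancel₀ _ hp.ne']
  · -- xss
    exact ⟨_, _, _, _, _, 1, ⟨a1, Or.inr ⟨rfl, rfl⟩⟩, ⟨a0, Or.inr ⟨rfl, rfl⟩⟩,
      ⟨(As_ij hadj).2 a2, Or.inl ⟨rfl, p, hp, rfl⟩⟩, D_one _, by rw [bssx i j hi hj hadj, mul_one]⟩
  · exact absurd (As_same.1 a0) (not_lt.2 (le_of_lt a2))
  · exact absurd (As_same.1 a0) (not_lt.2 (le_of_lt a2))
  · -- ssx
    exact ⟨_, _, _, _, _, 1, ⟨(As_ij hs).1 a0, Or.inl ⟨rfl, q, hq, rfl⟩⟩, ⟨a2, Or.inr ⟨rfl, rfl⟩⟩,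
      ⟨a1, Or.inr ⟨rfl, rfl⟩⟩, D_one _, by rw [bssx j i hj hi hs, mul_one]⟩
  · -- sss
    have b1 : As y i hi := (As_ij hs).1 a0
    exact ⟨_, _, _, _, _, 1, ⟨b1, Or.inr ⟨rfl, rfl⟩⟩, ⟨As_both hs a2 b1, Or.inr ⟨rfl, rfl⟩⟩,
      ⟨(As_ij hadj).2 a2, Or.inr ⟨by
        have := Sw_br i j hi hj hadj
        simp only [mul_assoc] at this ⊢
        rw [this], rfl⟩⟩, D_one _, by rw [bsss j i hj hi hs, mul_one]⟩

lemma MR_ex (k : ℕ) : ∀ (v w : Equiv.Perm (Fin n)) (g : RM n), MR k v w g →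
    ∀ (i : ℕ) (hi : i + 1 < n), Ds w i hi →
    ∃ k' v' g' G m, k = k' + 1 ∧ MR k' v' (w * Sw i hi) g' ∧ Step i hi v' v G ∧ D v m ∧
      g = g' * G * m := by
  induction k using Nat.strong_induction_on with
  | _ k IH =>
  intro v w g hM i hi hd
  cases hM with
  | one => exact (Ds_one hd).elim
  | step k0 j hj v0 v w0 g0 G m hM0 hS has hm =>
    have has' : As w0 j hj := has
    rcases tri i j with rfl | hf | hadj
    · exact ⟨k0, v0, g0, G, m, rfl, by rw [mSS]; exact hM0, hS, hm, rfl⟩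
    · obtain ⟨k1, v1, g1, G1, m1, rfl, hM1, hS1, hm1, rfl⟩ :=
        IH k0 (by omega) _ _ _ hM0 i hi ((Ds_far hf).1 hd)
      obtain ⟨m1', hm1', e1⟩ := push hS hm1
      obtain ⟨v0', t1, t2, e2⟩ := step_far hf hS1 hS
      refine ⟨k1 + 1, v0', g1 * G * 1, G1, m1' * m, rfl, ?_, t2, D_mul hm1' hm, ?_⟩
      · rw [mul_assoc w0, ← Sw_cm i j hi hj hf, ← mul_assoc]
        exact MR.step _ _ _ _ _ _ _ _ _ hM1 t1 ((As_far hf.symm).2 has') (D_one _)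
      · calc g1 * G1 * m1 * G * m = g1 * G1 * (m1 * G) * m := by simp only [mul_assoc]
          _ = g1 * (G1 * G) * m1' * m := by rw [e1]; simp only [mul_assoc]
          _ = _ := by rw [e2]; simp only [mul_assoc, one_mul]
    · obtain ⟨d1, d2, a1, a2⟩ := rk2 hadj has' hd
      obtain ⟨k1, v1, g1, G1, m1, rfl, hM1, hS1, hm1, rfl⟩ := IH k0 (by omega) _ _ _ hM0 i hi d1
      obtain ⟨k2, v2, g2, G2, m2, rfl, hM2, hS2, hm2, rfl⟩ := IH k1 (by omega) _ _ _ hM1 j hj d2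
      obtain ⟨m2', hm2', e2⟩ := push hS1 hm2
      obtain ⟨m1', hm1', e1⟩ := push hS (D_mul hm2' hm1)
      obtain ⟨a, b, H1, H2, H3, q, t1, t2, t3, hq, e⟩ := step_adj hadj hS2 hS1 hS
      have N1 := MR.step _ _ _ _ _ _ _ _ _ hM2 t1 a1 (D_one _)
      have N2 := MR.step _ _ _ _ _ _ _ _ _ N1 t2 a2 (D_one _)
      rw [wbr w0 i j hi hj hadj] at N2
      refine ⟨_, b, _, H3, q * (m1' * m), rfl, N2, t3, D_mul hq (D_mul hm1' hm), ?_⟩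
      calc g2 * G2 * m2 * G1 * m1 * G * m = g2 * G2 * (m2 * G1) * m1 * G * m := by simp only [mul_assoc]
        _ = g2 * G2 * G1 * ((m2' * m1) * G) * m := by rw [e2]; simp only [mul_assoc]
        _ = g2 * (G2 * G1 * G) * m1' * m := by rw [e1]; simp only [mul_assoc]
        _ = _ := by rw [e]; simp only [mul_assoc, one_mul]

def AddP (v u : Equiv.Perm (Fin n)) : Prop := ∀ a b, a < b → u b < u a → v (u b) < v (u a)

lemma ep_mul {u v : Equiv.Perm (Fin n)} (h : AddP u v) (b : Fin n) :
    ep (u * v) b = ep u (v b) * ep v b := by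
  unfold ep
  rw [← pow_add]
  congr 1
  have e : (univ.filter fun k : Fin n => v b < k ∧ u k < u (v b)).card =
      (univ.filter fun k : Fin n => (b < k ∧ v b < v k) ∧ u (v k) < u (v b)).card := by
    symm
    apply Finset.card_bij (fun k _ => v k)
    · intro k hk; simp only [mem_filter, mem_univ, true_and] at hk ⊢; exact ⟨hk.1.2, hk.2⟩
    · intro _ _ _ _ hh; exact v.injective hh
    · intro k hk
      simp only [mem_filter, mem_univ, true_and] at hk
      obtain ⟨k, rfl⟩ := v.surjective k
      refine ⟨k, ?_, rfl⟩
      simp only [mem_filter, mem_univ, true_and]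
      refine ⟨⟨?_, hk.1⟩, hk.2⟩
      rcases lt_trichotomy b k with h1 | rfl | h1
      · exact h1
      · exact absurd hk.1 (lt_irrefl _)
      · exact absurd (h k b h1 hk.1) (not_lt.2 hk.2.le)
  rw [e, ← Finset.card_union_of_disjoint]
  · congr 1
    ext k
    rw [mem_union, mem_filter, mem_filter, mem_filter]
    simp only [mem_univ, true_and, Equiv.Perm.mul_apply]
    constructor
    · rintro ⟨h1, h2⟩
      rcases lt_trichotomy (v b) (v k) with h3 | h3 | h3
      · exact Or.inl ⟨⟨h1, h3⟩, h2⟩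
      · exact absurd (v.injective h3) h1.ne
      · exact Or.inr ⟨h1, h3⟩
    · rintro (⟨⟨h1, _⟩, h2⟩ | ⟨h1, h2⟩)
      · exact ⟨h1, h2⟩
      · exact ⟨h1, h b k h1 h2⟩
  · rw [Finset.disjoint_left]
    intro k hk hk'
    simp only [mem_filter, mem_univ, true_and] at hk hk'
    exact absurd hk.1.2 (not_lt.2 hk'.2.le)

lemma pdot_apply (u : Equiv.Perm (Fin n)) (a b : Fin n) :
    (pdot u : RM n) a b = if a = u b then ep u b else 0 := rfl

lemma pdot_mul {u v : Equiv.Perm (Fin n)} (h : AddP u v) :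
    (pdot u * pdot v : RM n) = pdot (u * v) := by
  ext a b
  rw [mul_pdot, pdot_apply, pdot_apply, ep_mul h, Equiv.Perm.mul_apply]
  split_ifs <;> simp

lemma Add_Sw {v : Equiv.Perm (Fin n)} {i : ℕ} {h : i + 1 < n} (hv : As v i h) : AddP v (Sw i h) := by
  intro a b hab hs
  rcases Sw_lt i h hab with h1 | ⟨rfl, rfl⟩
  · exact absurd hs (not_lt.2 h1.le)
  · rw [Sw0, Sw1]; exact hv

lemma pdot_Sm {v : Equiv.Perm (Fin n)} {i : ℕ} {h : i + 1 < n} (hv : As v i h) :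
    (pdot v * Sm i : RM n) = pdot (v * Sw i h) := by
  rw [Sm_eq i h, pdot_mul (Add_Sw hv)]

lemma pdot_one : (pdot 1 : RM n) = 1 := by
  ext a b
  have : ep (1 : Equiv.Perm (Fin n)) b = 1 := by
    unfold ep
    rw [Finset.filter_false_of_mem, Finset.card_empty, pow_zero]
    intro x _ hx
    exact absurd hx.1 (not_lt.2 (le_of_lt hx.2))
  rw [pdot_apply, this, Matrix.one_apply]; rfl

lemma MRvv {k : ℕ} {v w : Equiv.Perm (Fin n)} {g : RM n} (hM : MR k v w g) :
    v = w → ∃ m, D v m ∧ g = pdot v * m := by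
  induction hM with
  | one => intro _; exact ⟨1, D_one _, by rw [pdot_one, one_mul]⟩
  | step k i h v' v w g G m hM hS ha hm ih =>
    intro e
    obtain ⟨a1, ⟨rfl, t, ht, rfl⟩ | ⟨rfl, rfl⟩⟩ := hS
    · have a1' : As v i h := a1
      rw [e] at a1'
      exact absurd (As_same.1 a1') (not_lt.2 (le_of_lt ha))
    · obtain ⟨q, hq, rfl⟩ := ih (mul_right_cancel e)
      obtain ⟨h1, h2⟩ := push_s i h a1 hq
      refine ⟨_, D_mul h1 hm, ?_⟩
      rw [← pdot_Sm a1, mul_assoc _ q, h2]; simp only [mul_assoc]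

lemma all_As {u : Equiv.Perm (Fin n)} (h : ∀ i hi, As u i hi) : u = 1 := by
  have key : ∀ d a (ha : a + d < n), (u ⟨a, by omega⟩ : ℕ) + d ≤ (u ⟨a + d, ha⟩ : ℕ) := by
    intro d
    induction d with
    | zero => intro a ha; simp
    | succ d ih =>
      intro a ha
      have h1 := ih a (by omega)
      have h2 : u ⟨a + d, by omega⟩ < u ⟨a + d + 1, ha⟩ := h (a + d) ha
      rw [Fin.lt_def] at h2
      have : (u ⟨a + (d + 1), ha⟩ : ℕ) = (u ⟨a + d + 1, ha⟩ : ℕ) := rfl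
      omega
  ext x
  have hx := x.2
  have h1 := key x 0 (by omega)
  have h2 := key (n - 1 - x) x (by omega)
  simp only [zero_add, Fin.eta] at h1
  have h3 := (u ⟨x + (n - 1 - x), by omega⟩).2
  simp only [Fin.eta] at h2
  simp only [Equiv.Perm.one_apply]
  omega

lemma mul_SmT (i : ℕ) (h : i + 1 < n) (M : RM n) (a b : Fin n) :
    (M * (Sm i)ᵀ : RM n) a b = if (b : ℕ) = i then M a (c1 i h) else
      if (b : ℕ) = i + 1 then - M a (c0 i h) else M a b := by
  have e : M = (M * (Sm i)ᵀ : RM n) * Sm i := by rw [mul_assoc, SmT' i h, mul_one]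
  obtain ⟨N, hN⟩ : ∃ N, N = (M * (Sm i)ᵀ : RM n) := ⟨_, rfl⟩
  rw [← hN] at e ⊢
  have f := fun b => mul_Sm i h N a b
  rw [← e] at f
  split_ifs with h0 h1
  · obtain rfl : b = c0 i h := Fin.ext h0
    have := f (c1 i h); simp at this; exact this.symm
  · obtain rfl : b = c1 i h := Fin.ext h1
    have := f (c0 i h); simp at this; rw [this, neg_neg]
  · have := f b; rw [if_neg h0, if_neg h1] at this; exact this.symm

lemma ext2 (i : ℕ) (h : i + 1 < n) (A B : RM n)
    (e0 : ∀ p, A p (c0 i h) = B p (c0 i h)) (e1 : ∀ p, A p (c1 i h) = B p (c1 i h))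
    (e2 : ∀ p (q : Fin n), (q : ℕ) ≠ i → (q : ℕ) ≠ i + 1 → A p q = B p q) : A = B := by
  ext p q
  by_cases h0 : (q : ℕ) = i
  · obtain rfl : q = c0 i h := Fin.ext h0
    exact e0 p
  · by_cases h1 : (q : ℕ) = i + 1
    · obtain rfl : q = c1 i h := Fin.ext h1
      exact e1 p
    · exact e2 p q h0 h1

lemma L_form (i : ℕ) (h : i + 1 < n) (a : ℝ) (ha : 0 < a) :
    (Xm i (1/a) * (Sm i)ᵀ * Xm i a : RM n) = Lm i h (1/a) 1 a := by
  refine mul_ext _ _ fun M => ?_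
  simp only [← mul_assoc]
  apply ext2 i h
  · intro p; simp [mul_Xm i h, mul_SmT i h, mul_Lm i h]; ring
  · intro p; simp [mul_Xm i h, mul_SmT i h, mul_Lm i h]; field_simp; ring
  · intro p q h0 h1; simp [mul_Xm i h, mul_SmT i h, mul_Lm i h, h0, h1]

lemma XS (i : ℕ) (h : i + 1 < n) (c : ℝ) : (Xm i c * Sm i : RM n) = Sm i * Ym i (-c) := by
  refine mul_ext _ _ fun M => ?_
  simp only [← mul_assoc]
  apply ext2 i h
  · intro p; simp [mul_Xm i h, mul_Sm i h, mul_Ym i h]; ring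
  · intro p; simp [mul_Xm i h, mul_Sm i h, mul_Ym i h]
  · intro p q h0 h1; simp [mul_Xm i h, mul_Sm i h, mul_Ym i h, h0, h1]

lemma R_form (i : ℕ) (h : i + 1 < n) (α β γ c : ℝ)
    (hU : U fi (Lm i h α β γ * Xm i (-c) * Sm i : RM n)) :
    (Lm i h α β γ * Xm i (-c) * Sm i : RM n) = Xm i α := by
  have hc := (c01 i h).ne
  have e1 := hU.1 (c0 i h)
  have e2 := hU.1 (c1 i h)
  have e3 := hU.2 (c1 i h) (c0 i h) (fi_lt.2 (c01 i h))
  simp [mul_Xm i h, mul_Sm i h, Lm, hc] at e1 e2 e3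
  refine mul_ext _ _ fun M => ?_
  simp only [← mul_assoc]
  apply ext2 i h
  · intro p; simp [mul_Xm i h, mul_Sm i h, mul_Lm i h]
    linear_combination M p (c0 i h) * e1 + M p (c1 i h) * e3
  · intro p; simp [mul_Xm i h, mul_Sm i h, mul_Lm i h]
    linear_combination M p (c1 i h) * e2
  · intro p q h0 h1; simp [mul_Xm i h, mul_Sm i h, mul_Lm i h, h0, h1]

def Inv (v u : Equiv.Perm (Fin n)) (g : RM n) : Prop :=
  ∃ k yp ym p, g = pdot v * yp * ym ∧ U fi yp ∧ D v ym ∧ U fi p ∧ U (fnp v) p ∧ TP k u⁻¹ (p * yp)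

lemma caseA {v u : Equiv.Perm (Fin n)} {i : ℕ} {h : i + 1 < n} {g m : RM n} {t : ℝ} (ht : 0 < t)
    (hv : As v i h) (hu : Ds u i h) (hI : Inv v (u * Sw i h) g) (hm : D v m) :
    Inv v u (g * Xm i t * m) := by
  obtain ⟨k, yp, ym, p, rfl, h1, h2, h3, h4, h5⟩ := hI
  obtain ⟨q, hq, e⟩ := push_x i h hv t h2
  refine ⟨k + 1, yp * Xm i t, q * m, p, ?_, U_mul fi_inj h1 (U_X i h t (fi_lt.2 (c01 i h))),
    D_mul hq hm, h3, h4, ?_⟩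
  · rw [mul_assoc _ ym, e]; simp only [mul_assoc]
  · have := TP_app h5 i h t ht (by rw [inv_inv]; exact As_same.2 hu)
    rw [_root_.mul_inv_rev, Equiv.swap_inv, ← mul_assoc, Sw_sq, one_mul, mul_assoc] at this
    exact this

lemma caseB {v' u : Equiv.Perm (Fin n)} {i : ℕ} {h : i + 1 < n} {g m : RM n}
    (hv : As v' i h) (hu : Ds u i h) (hA : AddP (v' * Sw i h) u)
    (hI : Inv v' (Sw i h * u * Sw i h) g) (hm : D (v' * Sw i h) m) :
    Inv (v' * Sw i h) u (g * Sm i * m) := by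
  obtain ⟨k, yp, ym, p, rfl, h1, h2, h3, h4, h5⟩ := hI
  have hd : Ds (v' * Sw i h) i h := Ds_same.2 hv
  have hlt : u⁻¹ (c0 i h) < u⁻¹ (c1 i h) := by
    rcases lt_trichotomy (u⁻¹ (c0 i h)) (u⁻¹ (c1 i h)) with g1 | g1 | g1
    · exact g1
    · exact absurd (u⁻¹.injective g1) (c01 i h).ne
    · have := hA _ _ g1 (by simpa using c01 i h)
      have q : ∀ x, u (u⁻¹ x) = x := fun x => by simp
      rw [q, q] at this
      exact absurd this (not_lt.2 (le_of_lt hd))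
  have hDs : Ds (Sw i h * u * Sw i h)⁻¹ i h := by
    unfold Ds
    simp only [_root_.mul_inv_rev, Equiv.swap_inv, Equiv.Perm.mul_apply, Sw0, Sw1]
    rcases Sw_lt i h hlt with g1 | ⟨g1, g2⟩
    · exact g1
    · exfalso
      rw [Equiv.Perm.inv_eq_iff_eq] at g1 g2
      unfold Ds at hu
      rw [← g1, ← g2] at hu
      exact absurd hu (not_lt.2 (c01 i h).le)
  obtain ⟨k', a, z, rfl, ha, hz, ez⟩ := TP_ex _ _ _ h5 i h hDs
  have ey : (Sw i h * u * Sw i h)⁻¹ * Sw i h = Sw i h * u⁻¹ := by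
    simp only [_root_.mul_inv_rev, Equiv.swap_inv, mul_assoc, Sw_sq, mul_one]
  rw [ey] at hz
  obtain ⟨c, hc⟩ : ∃ c, c = yp (c0 i h) (c1 i h) := ⟨_, rfl⟩
  obtain ⟨hq1, hq2⟩ := push_s i h hv h2
  obtain ⟨z', α, β, γ, hα, hβ, hγ, hz', eL⟩ := TP_L i h hz (1/a) 1 a (by positivity) one_pos ha
  have hp0 : p (c0 i h) (c1 i h) = 0 := h4.2 _ _ (fnp_lt.2 hv)
  have Uyp : U fi ((Sm i : RM n)ᵀ * (yp * Xm i (-c)) * Sm i) := by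
    apply conj_up i h
    · exact U_mul fi_inj h1 (U_X i h _ (fi_lt.2 (c01 i h)))
    · simp [mul_Xm i h, h1.1, hc]
  have Up : U fi (Xm i (1/a) * ((Sm i : RM n)ᵀ * p * Sm i)) :=
    U_mul fi_inj (U_X i h _ (fi_lt.2 (c01 i h))) (conj_up i h h3 hp0)
  have Up' : U (fnp (v' * Sw i h)) (Xm i (1/a) * ((Sm i : RM n)ᵀ * p * Sm i)) := by
    refine U_mul (fnp_inj _) (U_X i h _ (fnp_lt.2 hd)) ?_
    rw [fnp_mul, Sm_eq i h]; exact U_conj _ h4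
  have ezz : (Xm i (1/a) * ((Sm i : RM n)ᵀ * p * Sm i)) * ((Sm i : RM n)ᵀ * (yp * Xm i (-c)) * Sm i) =
      z' * (Lm i h α β γ * Xm i (-c) * Sm i) := by
    calc _ = Xm i (1/a) * (Sm i)ᵀ * p * (Sm i * (Sm i)ᵀ) * yp * Xm i (-c) * Sm i := by
          simp only [mul_assoc]
      _ = Xm i (1/a) * (Sm i)ᵀ * (p * yp) * Xm i (-c) * Sm i := by
          rw [SmT i h]; simp only [mul_assoc, one_mul]
      _ = (Xm i (1/a) * (Sm i)ᵀ * Xm i a) * z * Xm i (-c) * Sm i := by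
          rw [ez]; simp only [mul_assoc]
      _ = _ := by rw [L_form i h a ha, eL]; simp only [mul_assoc]
  have Uz' := TP_U hz'
  have du : IsUnit z'.det := by rw [U_fi_det Uz']; exact isUnit_one
  have UR : U fi (Lm i h α β γ * Xm i (-c) * Sm i : RM n) := by
    have e : (Lm i h α β γ * Xm i (-c) * Sm i : RM n) = z'⁻¹ * (z' * (Lm i h α β γ * Xm i (-c) * Sm i)) := by
      rw [← mul_assoc, Matrix.nonsing_inv_mul _ du, one_mul]
    rw [e, ← ezz]
    exact U_mul fi_inj (U_inv fi_inj Uz' du) (U_mul fi_inj Up Uyp)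
  rw [R_form i h α β γ c UR] at ezz
  refine ⟨k' + 1, _, Ym i (-c) * ((Sm i : RM n)ᵀ * ym * Sm i) * m, _, ?_, Uyp,
    D_mul (D_mul (D_Y i h hd _) hq1) hm, Up, Up', ?_⟩
  · have ex : (Xm i (-c) * Xm i c : RM n) = 1 := by rw [Xm_add i h, neg_add_cancel, Xm_zero]
    calc pdot v' * yp * ym * Sm i * m = pdot v' * yp * (ym * Sm i) * m := by simp only [mul_assoc]
      _ = pdot v' * yp * (Xm i (-c) * Xm i c) * Sm i * ((Sm i : RM n)ᵀ * ym * Sm i) * m := by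
          rw [hq2, ex]; simp only [mul_assoc, one_mul]
      _ = pdot v' * yp * Xm i (-c) * (Xm i c * Sm i) * ((Sm i : RM n)ᵀ * ym * Sm i) * m := by
          simp only [mul_assoc]
      _ = pdot v' * (Sm i * (Sm i)ᵀ) * yp * Xm i (-c) * Sm i * Ym i (-c) * ((Sm i : RM n)ᵀ * ym * Sm i) * m := by
          rw [XS i h, SmT i h]; simp only [mul_assoc, one_mul]
      _ = _ := by rw [← pdot_Sm hv]; simp only [mul_assoc]
  · rw [ezz]
    have := TP_app hz' i h α hα (by
      rw [_root_.mul_inv_rev, inv_inv, Equiv.swap_inv]; exact As_same.2 hu)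
    rwa [← mul_assoc, Sw_sq, one_mul] at this

lemma main_inv (k : ℕ) : ∀ (v u : Equiv.Perm (Fin n)) (g : RM n), AddP v u → MR k v (v * u) g →
    Inv v u g := by
  induction k with
  | zero =>
    intro v u g hA hM
    have h1 : v = v * u := by
      generalize hw : v * u = w at hM
      cases hM
      rfl
    have hu : u = 1 := by simpa using h1.symm
    subst hu
    obtain ⟨m, hm, rfl⟩ := MRvv hM h1
    exact ⟨0, 1, m, 1, by simp, U_one _, hm, U_one _, U_one _, by simpa using TP.one⟩
  | succ k IH =>
    intro v u g hA hM
    by_cases hu : u = 1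
    · subst hu
      obtain ⟨m, hm, rfl⟩ := MRvv hM (by simp)
      exact ⟨0, 1, m, 1, by simp, U_one _, hm, U_one _, U_one _, by simpa using TP.one⟩
    · have : ∃ i hi, Ds u i hi := by
        by_contra hcon
        push Not at hcon
        exact hu (all_As fun i hi => by by_contra hh; exact hcon i hi (nAs.1 hh))
      obtain ⟨i, h, hd⟩ := this
      have hwd : Ds (v * u) i h := hA _ _ (c01 i h) hd
      obtain ⟨k', v', g', G, m, e, hM', hS, hm, rfl⟩ := MR_ex _ _ _ _ hM i h hwd
      obtain rfl : k = k' := by omega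
      obtain ⟨a1, ⟨rfl, t, ht, rfl⟩ | ⟨rfl, rfl⟩⟩ := hS
      · refine caseA ht a1 hd (IH _ _ _ ?_ (by rw [← mul_assoc]; exact hM')) hm
        intro a b hab hlt
        simp only [Equiv.Perm.mul_apply] at hlt ⊢
        rcases Sw_lt i h hab with g1 | ⟨rfl, rfl⟩
        · exact hA _ _ g1 hlt
        · rw [Sw0, Sw1] at hlt; exact absurd hlt (not_lt.2 (le_of_lt hd))
      · refine caseB a1 hd hA (IH _ _ _ ?_ (by simp only [← mul_assoc]; exact hM')) hm
        have hvd : v' (Sw i h (c1 i h)) < v' (Sw i h (c0 i h)) := by rw [Sw0, Sw1]; exact a1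
        intro a b hab hlt
        simp only [Equiv.Perm.mul_apply] at hlt ⊢
        rcases Sw_lt i h hab with g1 | ⟨rfl, rfl⟩
        · rcases lt_trichotomy (u (Sw i h b)) (u (Sw i h a)) with g2 | g2 | g2
          · exact hA _ _ g1 g2
          · rw [g2] at hlt; exact absurd hlt (lt_irrefl _)
          · rcases Sw_lt i h g2 with g3 | ⟨g3, g4⟩
            · exact absurd hlt (not_lt.2 g3.le)
            · rw [g3, g4]; exact hvd
        · rw [Sw0, Sw1] at hlt ⊢
          rcases Sw_lt i h hd with g3 | ⟨g3, g4⟩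
          · exact absurd hlt (not_lt.2 g3.le)
          · rw [g3, g4]; exact hvd

lemma len_count (u v : Equiv.Perm (Fin n)) : len u + len v = len (u * v) +
    ((univ.filter fun p : Fin n × Fin n => p.1 < p.2 ∧ v p.2 < v p.1 ∧ u (v p.1) < u (v p.2)).card +
    (univ.filter fun p : Fin n × Fin n => p.2 < p.1 ∧ v p.1 < v p.2 ∧ u (v p.2) < u (v p.1)).card) := by
  have e1 : len u = (univ.filter fun p : Fin n × Fin n => v p.1 < v p.2 ∧ u (v p.2) < u (v p.1)).card := by
    unfold len
    symm
    apply Finset.card_bij (fun p _ => (v p.1, v p.2))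
    · intro p hp; simpa using hp
    · rintro ⟨a, b⟩ _ ⟨c, d⟩ _ hh; simpa using hh
    · rintro ⟨a, b⟩ hp
      refine ⟨(v⁻¹ a, v⁻¹ b), ?_, by simp⟩
      simpa using hp
  have e2 : len v = (univ.filter fun p : Fin n × Fin n => p.1 < p.2 ∧ v p.2 < v p.1).card := rfl
  have e3 : len (u * v) = (univ.filter fun p : Fin n × Fin n => p.1 < p.2 ∧ u (v p.2) < u (v p.1)).card := rfl
  rw [e1, e2, e3]
  simp only [Finset.card_filter]
  rw [← Finset.sum_add_distrib, ← Finset.sum_add_distrib, ← Finset.sum_add_distrib]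
  apply Finset.sum_congr rfl
  rintro ⟨a, b⟩ _
  simp only
  rcases lt_trichotomy a b with h | rfl | h
  · have hv : v a ≠ v b := fun e => h.ne (v.injective e)
    have hu : u (v a) ≠ u (v b) := fun e => hv (u.injective e)
    rcases lt_or_gt_of_ne hv with h1 | h1 <;> rcases lt_or_gt_of_ne hu with h2 | h2 <;>
      simp [h, h1, h2, h.not_gt, h1.not_gt, h2.not_gt]
  · simp
  · have hv : v a ≠ v b := fun e => h.ne (v.injective e).symm
    have hu : u (v a) ≠ u (v b) := fun e => hv (u.injective e)
    rcases lt_or_gt_of_ne hv with h1 | h1 <;> rcases lt_or_gt_of_ne hu with h2 | h2 <;>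
      simp [h, h1, h2, h.not_gt, h1.not_gt, h2.not_gt]

lemma Add_of_len {u v : Equiv.Perm (Fin n)} (h : len (u * v) = len u + len v) : AddP u v := by
  have hc := len_count u v
  have h0 : (univ.filter fun p : Fin n × Fin n =>
      p.1 < p.2 ∧ v p.2 < v p.1 ∧ u (v p.1) < u (v p.2)).card = 0 := by omega
  rw [Finset.card_eq_zero, Finset.filter_eq_empty_iff] at h0
  intro a b hab hv
  have h1 := h0 (Finset.mem_univ (a, b))
  simp only [hab, hv, true_and, not_lt] at h1
  exact lt_of_le_of_ne h1 fun e => hv.ne (u.injective e)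

lemma len_of_Add {u v : Equiv.Perm (Fin n)} (h : AddP u v) : len (u * v) = len u + len v := by
  have hc := len_count u v
  have h0 : (univ.filter fun p : Fin n × Fin n =>
      p.1 < p.2 ∧ v p.2 < v p.1 ∧ u (v p.1) < u (v p.2)) = ∅ := by
    rw [Finset.filter_eq_empty_iff]
    rintro ⟨a, b⟩ _ ⟨h1, h2, h3⟩
    exact absurd (h a b h1 h2) (not_lt.2 h3.le)
  have h0' : (univ.filter fun p : Fin n × Fin n =>
      p.2 < p.1 ∧ v p.1 < v p.2 ∧ u (v p.2) < u (v p.1)) = ∅ := by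
    rw [Finset.filter_eq_empty_iff]
    rintro ⟨a, b⟩ _ ⟨h1, h2, h3⟩
    exact absurd (h b a h1 h2) (not_lt.2 h3.le)
  rw [h0, h0', Finset.card_empty] at hc
  omega

lemma len_Sw (i : ℕ) (h : i + 1 < n) : len (Sw i h) = 1 := by
  unfold len
  rw [Finset.card_eq_one]
  refine ⟨(c0 i h, c1 i h), ?_⟩
  ext ⟨a, b⟩
  rw [mem_filter, mem_singleton]
  constructor
  · rintro ⟨_, h1, h2⟩
    rcases Sw_lt i h h1 with h3 | ⟨rfl, rfl⟩
    · exact absurd h2 (not_lt.2 h3.le)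
    · rfl
  · intro e
    obtain ⟨rfl, rfl⟩ := Prod.mk.inj e
    refine ⟨mem_univ _, c01 i h, ?_⟩
    simp only
    rw [Sw0, Sw1]; exact c01 i h

lemma len_As {w : Equiv.Perm (Fin n)} {i : ℕ} {h : i + 1 < n} (ha : As w i h) :
    len (w * Sw i h) = len w + 1 := by rw [len_of_Add (Add_Sw ha), len_Sw]

lemma len_Ds {w : Equiv.Perm (Fin n)} {i : ℕ} {h : i + 1 < n} (ha : Ds w i h) :
    len (w * Sw i h) + 1 = len w := by
  have := len_As (As_same.2 ha)
  rw [mSS] at this; exact this.symm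

lemma len_le (w : Equiv.Perm (Fin n)) (i : ℕ) (h : i + 1 < n) : len (w * Sw i h) ≤ len w + 1 := by
  by_cases ha : As w i h
  · exact (len_As ha).le
  · have := len_Ds (nAs.1 ha); omega

lemma len_one : len (1 : Equiv.Perm (Fin n)) = 0 := by
  unfold len
  rw [Finset.card_eq_zero, Finset.filter_eq_empty_iff]
  rintro ⟨a, b⟩ _ ⟨h1, h2⟩
  exact absurd h1 (not_lt.2 (le_of_lt h2))

lemma sperm_eq (i : ℕ) (h : i + 1 < n) : sperm n (i + 1) = Sw i h := by
  unfold sperm; rw [dif_pos h]; rfl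

lemma link {n m : ℕ} (v w : Equiv.Perm (Fin n))
    (ii : Fin m → ℕ) (hii : ∀ r, 1 ≤ ii r ∧ ii r < n)
    (hw : w = (sPermList n ii).prod) (hred : len w = m)
    (hv0 : vseq ii v m = 1)
    (t : Fin m → ℝ) (ht : ∀ r, inJ ii v r → 0 < t r) : MR m v w (mrg ii v t) := by
  have hlen : (sPermList n ii).length = m := by simp [sPermList]
  have hlen' : (mrgList ii v t).length = m := by simp [mrgList]
  have hi : ∀ r (hr : r < m), ∃ i, ∃ (h : i + 1 < n), ii ⟨r, hr⟩ = i + 1 := by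
    intro r hr
    have := hii ⟨r, hr⟩
    exact ⟨ii ⟨r, hr⟩ - 1, by omega, by omega⟩
  have hs : ∀ r (hr : r < m), ((sPermList n ii).take (r + 1)).prod =
      ((sPermList n ii).take r).prod * sperm n (ii ⟨r, hr⟩) := by
    intro r hr
    rw [List.prod_take_succ _ _ (by rw [hlen]; exact hr)]
    simp [sPermList]
  have hg : ∀ r (hr : r < m), ((mrgList ii v t).take (r + 1)).prod =
      ((mrgList ii v t).take r).prod *
        (if inJ ii v ⟨r, hr⟩ then xmat (ii ⟨r, hr⟩) (t ⟨r, hr⟩) else sdot (ii ⟨r, hr⟩)) := by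
    intro r hr
    rw [List.prod_take_succ _ _ (by rw [hlen']; exact hr)]
    simp [mrgList]
  have hb : ∀ d r, r + d ≤ m → len ((sPermList n ii).take (r + d)).prod ≤
      len ((sPermList n ii).take r).prod + d := by
    intro d
    induction d with
    | zero => intro r _; simp
    | succ d ih =>
      intro r hr
      obtain ⟨i, h, e⟩ := hi (r + d) (by omega)
      have h1 := hs (r + d) (by omega)
      rw [e, sperm_eq i h] at h1
      have h2 := len_le ((sPermList n ii).take (r + d)).prod i h
      have h3 := ih r (by omega)
      rw [← h1] at h2
      have : (r + (d + 1)) = r + d + 1 := rfl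
      rw [this]; omega
  have hfull : ((sPermList n ii).take m).prod = w := by
    rw [hw]; congr 1; exact List.take_of_length_le hlen.le
  have hasc : ∀ r (hr : r < m) i (h : i + 1 < n), ii ⟨r, hr⟩ = i + 1 →
      As ((sPermList n ii).take r).prod i h := by
    intro r hr i h e
    by_contra hcon
    have h1 := len_Ds (nAs.1 hcon)
    have h2 := hs r hr
    rw [e, sperm_eq i h] at h2
    rw [← h2] at h1
    have h3 := hb (m - (r + 1)) (r + 1) (by omega)
    have h4 := hb r 0 (by omega)
    have : r + 1 + (m - (r + 1)) = m := by omega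
    rw [this, hfull] at h3
    rw [List.take_zero, List.prod_nil, len_one, zero_add] at h4
    omega
  have main : ∀ r, r ≤ m → MR r (vseq ii v (m - r)) ((sPermList n ii).take r).prod
      ((mrgList ii v t).take r).prod := by
    intro r
    induction r with
    | zero => intro _; simp [hv0]; exact MR.one
    | succ r ih =>
      intro hr
      have hr' : r < m := hr
      have h0 := ih (by omega)
      obtain ⟨i, h, e⟩ := hi r hr'
      have ha := hasc r hr' i h e
      obtain ⟨k, hk⟩ : ∃ k, k = m - (r + 1) := ⟨_, rfl⟩
      have hk1 : m - r = k + 1 := by omega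
      have hk2 : m - k - 1 = r := by omega
      have hvs : vseq ii v (k + 1) = if len (vseq ii v k * Sw i h) < len (vseq ii v k) then
          vseq ii v k * Sw i h else vseq ii v k := by
        have hlt : m - k - 1 < m := by omega
        have hidx : (⟨m - k - 1, hlt⟩ : Fin m) = ⟨r, hr'⟩ := Fin.ext hk2
        rw [← sperm_eq i h, ← e, ← hidx]
        conv_lhs => unfold vseq
        rw [dif_pos hlt]
      have hJ : inJ ii v ⟨r, hr'⟩ ↔ vseq ii v (k + 1) = vseq ii v k := by
        unfold inJ
        simp only
        rw [hk1]; rfl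
      rw [hk1] at h0
      rw [hs r hr', hg r hr', ← hk, e, sperm_eq i h]
      by_cases hd : As (vseq ii v k) i h
      · have e1 : vseq ii v (k + 1) = vseq ii v k := by
          rw [hvs, if_neg]; rw [len_As hd]; omega
        have hj := hJ.2 e1
        rw [if_pos hj]
        rw [e1] at h0
        have := MR.step _ i h _ _ _ _ _ 1 h0 ⟨hd, Or.inl ⟨rfl, t ⟨r, hr'⟩, ht _ hj, rfl⟩⟩ ha (D_one _)
        rw [mul_one] at this; exact this
      · have hd' := nAs.1 hd
        have e1 : vseq ii v (k + 1) = vseq ii v k * Sw i h := by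
          rw [hvs, if_pos]; have := len_Ds hd'; omega
        have hj : ¬ inJ ii v ⟨r, hr'⟩ := by
          rw [hJ, e1]
          intro hh
          have := len_Ds hd'
          rw [hh] at this; omega
        rw [if_neg hj]
        rw [e1] at h0
        have := MR.step _ i h _ (vseq ii v k) _ _ _ 1 h0
          ⟨As_same.2 hd', Or.inr ⟨(mSS _ _ _).symm, rfl⟩⟩ ha (D_one _)
        rw [mul_one] at this; exact this
  have := main m le_rfl
  rw [hfull, Nat.sub_self, List.take_of_length_le hlen'.le] at this
  exact this

def TF (g : RM n) : Prop := ∀ (k : ℕ) (hk : k ≤ n) (f : Fin k → Fin n), StrictMono f →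
  0 ≤ Matrix.det (Matrix.of fun a b : Fin k => g (Fin.castLE hk a) (f b))

lemma TF_top {g : RM n} (hg : TF g) : TopFlagNonneg g := by
  intro J
  unfold minor
  split_ifs with h
  · have hk : (univ.filter fun i : Fin n => (i : ℕ) < J.card).card ≤ n := by
      simpa using Finset.card_le_univ (univ.filter fun i : Fin n => (i : ℕ) < J.card)
    have e : (Fin.castLE hk) = ((univ.filter fun i : Fin n => (i : ℕ) < J.card).orderEmbOfFin rfl) := by
      apply Finset.orderEmbOfFin_unique
      · intro x
        rw [mem_filter]
        refine ⟨mem_univ _, ?_⟩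
        have := x.2
        simp only [Fin.val_castLE]; omega
      · intro a b hab; exact hab
    have := hg _ hk (J.orderEmbOfFin h.symm) (OrderEmbedding.strictMono _)
    rw [e] at this
    exact this
  · exact le_rfl

lemma TF_X {g : RM n} (hg : TF g) (i : ℕ) (h : i + 1 < n) (t : ℝ) (ht : 0 ≤ t) : TF (g * Xm i t) := by
  intro k hk f hf
  by_cases hb : ∃ b, f b = c1 i h
  · obtain ⟨b0, hb0⟩ := hb
    have e : (Matrix.of fun a b : Fin k => (g * Xm i t : RM n) (Fin.castLE hk a) (f b)) =
        (Matrix.of fun a b : Fin k => g (Fin.castLE hk a) (f b)).updateCol b0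
          ((fun a => g (Fin.castLE hk a) (f b0)) + t • (fun a => g (Fin.castLE hk a) (c0 i h))) := by
      ext a b
      by_cases hbb : b = b0
      · subst hbb
        simp [mul_Xm i h, hb0]
      · have hne : f b ≠ c1 i h := fun e => hbb (hf.injective (e.trans hb0.symm))
        have hne' : ¬ ((f b : ℕ) = i + 1) := fun e => hne (Fin.ext e)
        simp [mul_Xm i h, Matrix.updateCol_ne hbb, hne']
    rw [e, Matrix.det_updateCol_add, Matrix.det_updateCol_smul]
    have e1 : (Matrix.of fun a b : Fin k => g (Fin.castLE hk a) (f b)).updateCol b0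
        (fun a => g (Fin.castLE hk a) (f b0)) = Matrix.of fun a b : Fin k => g (Fin.castLE hk a) (f b) := by
      ext a b
      by_cases hbb : b = b0
      · subst hbb; simp
      · simp [Matrix.updateCol_ne hbb]
    have e2 : (Matrix.of fun a b : Fin k => g (Fin.castLE hk a) (f b)).updateCol b0
        (fun a => g (Fin.castLE hk a) (c0 i h)) =
        Matrix.of fun a b : Fin k => g (Fin.castLE hk a) (Function.update f b0 (c0 i h) b) := by
      ext a b
      by_cases hbb : b = b0
      · subst hbb; simp
      · simp [Matrix.updateCol_ne hbb, Function.update_of_ne hbb]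
    rw [e1, e2]
    have h1 := hg k hk f hf
    have h2 : 0 ≤ Matrix.det (Matrix.of fun a b : Fin k =>
        g (Fin.castLE hk a) (Function.update f b0 (c0 i h) b)) := by
      by_cases hc : ∃ b, f b = c0 i h
      · obtain ⟨b1, hb1⟩ := hc
        have hne : b1 ≠ b0 := by
          rintro rfl; rw [hb1] at hb0; exact (c01 i h).ne hb0
        rw [Matrix.det_zero_of_column_eq hne]
        intro a
        simp [Function.update_of_ne hne, hb1]
      · apply hg k hk
        push Not at hc
        intro x y hxy
        have hfxy := hf hxy
        by_cases hx : x = b0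
        · subst hx
          rw [Function.update_self, Function.update_of_ne hxy.ne']
          exact (c01 i h).trans (hb0 ▸ hfxy)
        · by_cases hy : y = b0
          · subst hy
            rw [Function.update_self, Function.update_of_ne hx]
            rw [hb0] at hfxy
            have h3 : (f x : ℕ) ≠ i := fun e => hc x (Fin.ext e)
            simp only [Fin.lt_def] at hfxy ⊢
            omega
          · rw [Function.update_of_ne hx, Function.update_of_ne hy]; exact hfxy
    positivity
  · push Not at hb
    have e : (Matrix.of fun a b : Fin k => (g * Xm i t : RM n) (Fin.castLE hk a) (f b)) =
        Matrix.of fun a b : Fin k => g (Fin.castLE hk a) (f b) := by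
      ext a b
      have hne' : ¬ ((f b : ℕ) = i + 1) := fun e => hb b (Fin.ext e)
      simp [mul_Xm i h, hne']
    rw [e]; exact hg k hk f hf

lemma TF_TP {k : ℕ} {y : Equiv.Perm (Fin n)} {z : RM n} (h : TP k y z) :
    ∀ g : RM n, TF g → TF (g * z) := by
  induction h with
  | one => intro g hg; rwa [mul_one]
  | step k j hj y z a _ _ ha ih =>
    intro g hg
    rw [← mul_assoc]
    exact ih _ (TF_X hg j hj a ha.le)

lemma TF_pdot (w : Equiv.Perm (Fin n)) : TF (pdot w : RM n) := by
  intro k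
  induction k with
  | zero => intro hk f hf; simp
  | succ k ih =>
    intro hk f hf
    by_cases hall : ∀ b, (w (f b) : ℕ) < k + 1
    · rw [Matrix.det_succ_row _ (Fin.last k)]
      apply Finset.sum_nonneg
      intro j _
      have hsub : (Matrix.of fun a b : Fin (k + 1) => (pdot w : RM n) (Fin.castLE hk a) (f b)).submatrix
          (Fin.last k).succAbove j.succAbove =
          Matrix.of fun a b : Fin k => (pdot w : RM n) (Fin.castLE (by omega) a) ((f ∘ j.succAbove) b) := by
        ext a b
        simp [Fin.succAbove_last]
      rw [hsub]
      have hd := ih (by omega) (f ∘ j.succAbove) (hf.comp (Fin.strictMono_succAbove j))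
      by_cases hj : Fin.castLE hk (Fin.last k) = w (f j)
      · have hjv : (w (f j) : ℕ) = k := by rw [← hj]; simp
        have hsur : ∀ x, (w x : ℕ) < k → ∃ b, f b = x := by
          have hinj : Function.Injective (fun b : Fin (k+1) => (⟨w (f b), hall b⟩ : Fin (k+1))) := by
            intro a b hab
            simp only [Fin.mk.injEq] at hab
            exact hf.injective (w.injective (Fin.ext hab))
          have hs := Finite.surjective_of_injective hinj
          intro x hx
          obtain ⟨b, hb⟩ := hs ⟨w x, by omega⟩
          simp only [Fin.mk.injEq] at hb
          exact ⟨b, w.injective (Fin.ext hb)⟩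
        have hcard : (univ.filter fun x : Fin n => f j < x ∧ w x < w (f j)).card = k - j := by
          have : (Finset.Ioi j).card = k - j := by rw [Fin.card_Ioi]; omega
          rw [← this]
          symm
          apply Finset.card_bij (fun b _ => f b)
          · intro b hb
            rw [Finset.mem_Ioi] at hb
            rw [mem_filter]
            refine ⟨mem_univ _, hf hb, ?_⟩
            have h1 := hall b
            have h2 : (w (f b) : ℕ) ≠ w (f j) := fun e =>
              hb.ne' (hf.injective (w.injective (Fin.ext e)))
            rw [Fin.lt_def]; omega
          · intro a _ b _ hab; exact hf.injective hab
          · intro x hx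
            rw [mem_filter] at hx
            obtain ⟨b, rfl⟩ := hsur x (by have := hx.2.2; rw [Fin.lt_def] at this; omega)
            exact ⟨b, Finset.mem_Ioi.2 (hf.lt_iff_lt.1 hx.2.1), rfl⟩
        have hep : ep w (f j) = (-1) ^ (k - (j : ℕ)) := by unfold ep; rw [hcard]
        rw [Matrix.of_apply, pdot_apply, if_pos hj, hep]
        have hjk := j.2
        have e1 : ((-1 : ℝ)) ^ (((Fin.last k : Fin (k+1)) : ℕ) + (j : ℕ)) * (-1) ^ (k - (j : ℕ)) = 1 := by
          rw [← pow_add, Fin.val_last]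
          have : k + (j : ℕ) + (k - j) = 2 * k := by omega
          rw [this, pow_mul]; norm_num
        rw [e1, one_mul]; exact hd
      · rw [Matrix.of_apply, pdot_apply, if_neg hj]; simp
    · push Not at hall
      obtain ⟨b, hb⟩ := hall
      rw [Matrix.det_eq_zero_of_column_eq_zero b]
      intro a
      rw [Matrix.of_apply, pdot_apply, if_neg]
      intro e
      have := a.2
      rw [← e] at hb
      simp at hb; omega

lemma U_IsN {a : RM n} : IsN a ↔ U fi a :=
  ⟨fun h => ⟨h.1, fun x y hxy => h.2 x y (fi_lt.1 hxy)⟩, fun h => ⟨h.1, fun x y hxy => h.2 x y (fi_lt.2 hxy)⟩⟩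
lemma U_IsNm {a : RM n} : IsNm a ↔ U fng a :=
  ⟨fun h => ⟨h.1, fun x y hxy => h.2 x y (fng_lt.1 hxy)⟩, fun h => ⟨h.1, fun x y hxy => h.2 x y (fng_lt.2 hxy)⟩⟩

lemma udl_unique {yp ym a b c : RM n} (hy : U fi yp) (hm : U fng ym) (ha : U fi a) (hc : U fng c)
    (hb : ∀ i j : Fin n, i ≠ j → b i j = 0) (e : yp * ym = a * b * c) : a = yp := by
  have dy : IsUnit yp.det := by rw [U_fi_det hy]; exact isUnit_one
  have dc : IsUnit c.det := by rw [U_fng_det hc]; exact isUnit_one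
  have hX : U fi (yp⁻¹ * a) := U_mul fi_inj (U_inv fi_inj hy dy) ha
  have hY : U fng (ym * c⁻¹) := U_mul fng_inj hm (U_inv fng_inj hc dc)
  have hXY : (yp⁻¹ * a) * b = ym * c⁻¹ := by
    calc (yp⁻¹ * a) * b = yp⁻¹ * (a * b * c) * c⁻¹ := by
          simp only [mul_assoc]; rw [Matrix.mul_nonsing_inv _ dc, mul_one]
      _ = (yp⁻¹ * yp) * ym * c⁻¹ := by rw [← e]; simp only [mul_assoc]
      _ = _ := by rw [Matrix.nonsing_inv_mul _ dy, one_mul]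
  have hent : ∀ p q, (yp⁻¹ * a) p q * b q q = (ym * c⁻¹) p q := by
    intro p q
    rw [← hXY]; symm; rw [Matrix.mul_apply, Finset.sum_eq_single q]
    · intro r _ hr; rw [hb r q hr, mul_zero]
    · simp
  have hbd : ∀ q, b q q = 1 := by
    intro q
    have := hent q q
    rwa [hX.1, hY.1, one_mul] at this
  have hX1 : yp⁻¹ * a = 1 := by
    ext p q
    rcases lt_trichotomy p q with h | rfl | h
    · have := hent p q
      rw [hbd, mul_one, hY.2 p q (fng_lt.2 h)] at this
      rw [this, Matrix.one_apply_ne h.ne]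
    · rw [hX.1, Matrix.one_apply_eq]
    · rw [hX.2 p q (fi_lt.2 h), Matrix.one_apply_ne h.ne']
  calc a = yp * (yp⁻¹ * a) := by rw [← mul_assoc, Matrix.mul_nonsing_inv _ dy, one_mul]
    _ = yp := by rw [hX1, mul_one]


/-- total nonnegativity of `B₋·u̇₁v̇[v̇⁻¹g]_L^+` (Lemma 6.2, type A). -/
theorem statement_9 {n m : ℕ} (hn : 1 ≤ n)
    (v u₁ u₂ : Equiv.Perm (Fin n))
    (hl1 : len (u₁ * v) = len u₁ + len v)
    (hl2 : len (v * u₂) = len v + len u₂)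
    (ii : Fin m → ℕ) (hii : ∀ r, 1 ≤ ii r ∧ ii r < n)
    (hw : v * u₂ = (sPermList n ii).prod) (hred : len (v * u₂) = m)
    (hpre : v = ((sPermList n ii).take (len v)).prod)
    (hv0 : vseq ii v m = 1)
    (t : Fin m → ℝ) (ht : ∀ r, inJ ii v r → 0 < t r) :
    (∃ a b c, UDL ((pdot v : Matrix (Fin n) (Fin n) ℝ)⁻¹ * mrg ii v t) a b c) ∧
    ∀ a b c, UDL ((pdot v : Matrix (Fin n) (Fin n) ℝ)⁻¹ * mrg ii v t) a b c →
      ∃ bm : Matrix (Fin n) (Fin n) ℝ, IsBm bm ∧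
        TopFlagNonneg (bm * pdot u₁ * pdot v * a) := by
  have hA1 : AddP u₁ v := Add_of_len hl1
  have hA2 : AddP v u₂ := Add_of_len hl2
  have hM := link v (v * u₂) ii hii hw hred hv0 t ht
  obtain ⟨k, yp, ym, p, eg, h1, h2, h3, h4, h5⟩ := main_inv m v u₂ _ hA2 hM
  have e0 : (pdot v : Matrix (Fin n) (Fin n) ℝ)⁻¹ * mrg ii v t = yp * ym := by
    rw [eg, pdot_inv, mul_assoc, ← mul_assoc _ (pdot v), pdotT_pdot, one_mul]
  rw [e0]
  constructor
  · refine ⟨yp, 1, ym, U_IsN.2 h1, ⟨Matrix.det_one, fun i j hij => Matrix.one_apply_ne hij⟩,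
      U_IsNm.2 h2.2, by rw [mul_one]⟩
  · rintro a b c ⟨ha, hb, hc, e⟩
    obtain rfl : a = yp := udl_unique h1 h2.2 (U_IsN.1 ha) (U_IsNm.1 hc) hb.2 e
    have hUp : U (fng ∘ (u₁ * v)) p := by
      refine ⟨h3.1, fun x y hxy => ?_⟩
      have hxy' : u₁ (v x) < u₁ (v y) := fng_lt.1 hxy
      rcases lt_trichotomy x y with g | rfl | g
      · apply h4.2
        rw [fnp_lt]
        rcases lt_trichotomy (v x) (v y) with g' | g' | g'
        · exact g'
        · exact absurd (v.injective g') g.ne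
        · exact absurd (hA1 x y g g') (not_lt.2 hxy'.le)
      · exact absurd hxy (lt_irrefl _)
      · exact h3.2 x y (fi_lt.2 g)
    have hB := U_conj' (u₁ * v) hUp
    refine ⟨_, ⟨U_fng_det hB, fun x y hxy => hB.2 x y (fng_lt.2 hxy)⟩, ?_⟩
    have e1 : (pdot (u₁ * v) : RM n) * p * (pdot (u₁ * v) : RM n)ᵀ * pdot u₁ * pdot v * a =
        pdot (u₁ * v) * (p * a) := by
      rw [mul_assoc _ (pdot u₁) (pdot v), pdot_mul hA1, mul_assoc _ _ (pdot (u₁ * v)), pdotT_pdot,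
        mul_one, mul_assoc]
    rw [e1]
    exact TF_top (TF_TP h5 _ (TF_pdot _))

end
end Paper
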